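/- Let m ≥ 1, κ_j > 0, a_j ≠ 0 for j = 1,…,m with Σ_{j=1}^m |a_j| ≤ 1, and let ξ_j ∈ C^∞([−1,1]) with ξ_j(t) = 0 for t ∈ [−1,−1/2]. For |x| ≤ 1 − Σ_{j=1}^m |a_j| define f_m(x) = ∫_{[−1,1]^m} P_n^{(α,β)}(Σ_{j=1}^m a_j t_j + x) ∏_{j=1}^m ξ_j(t_j)(1−t_j)^{κ_j−1} dt. If α ≥ β, then there exists a constant c > 0, depending only on α, β, m, the κ_j and the ξ_j, such that for all integers n ≥ 1 and all such a and x: |f_m(x)| ≤ c n^{α−2τ_m} (1 + n√(1−|A_m+x|))^{−α−1/2+τ_m} ∏_{j=1}^m |a_j|^{−κ_j}, where A_m = Σ_{j=1}^m a_j and τ_m = Σ_{j=1}^m κ_j. -/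

import Mathlib

open MeasureTheory Finset Real

/-- Generalized binomial coefficient `C(x, k) = x (x-1) ⋯ (x-k+1) / k!`. -/
noncomputable def genBinom (x : ℝ) (k : ℕ) : ℝ :=
  (∏ i ∈ Finset.range k, (x - i)) / (Nat.factorial k)

/-- Jacobi polynomial `P_n^{(a,b)}(t)`. -/
noncomputable def jacobiP (n : ℕ) (a b t : ℝ) : ℝ :=
  ∑ m ∈ Finset.range (n + 1),
    genBinom (n + a) (n - m) * genBinom (n + b) m * ((t - 1) / 2) ^ m * ((t + 1) / 2) ^ (n - m)

/-- The cube `[-1,1]^m`. -/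
def cube (m : ℕ) : Set (Fin m → ℝ) := Set.univ.pi fun _ => Set.Icc (-1) 1

theorem succ_mul_genBinom_succ (x : ℝ) (k : ℕ) :
    ((k : ℝ) + 1) * genBinom x (k + 1) = (x - k) * genBinom x k := by
  unfold genBinom
  rw [Finset.prod_range_succ, Nat.factorial_succ]
  have h : (Nat.factorial k : ℝ) ≠ 0 := by positivity
  have h' : (k : ℝ) + 1 ≠ 0 := by positivity
  push_cast
  field_simp

/-- The derivative of a Jacobi polynomial, obtained by differentiating its definition. -/
theorem hasDerivAt_jacobiP_sum (n : ℕ) (a b t : ℝ) :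
    HasDerivAt (jacobiP n a b)
      (∑ m ∈ Finset.range (n + 1), genBinom (n + a) (n - m) * genBinom (n + b) m *
        ((m : ℝ) * ((t - 1) / 2) ^ (m - 1) * (1 / 2) * ((t + 1) / 2) ^ (n - m) +
          ((t - 1) / 2) ^ m * (((n - m : ℕ) : ℝ) * ((t + 1) / 2) ^ (n - m - 1) * (1 / 2)))) t := by
  unfold jacobiP
  apply HasDerivAt.fun_sum
  intro m _
  have h1 : HasDerivAt (fun t : ℝ => (t - 1) / 2) (1 / 2) t :=
    ((hasDerivAt_id t).sub_const 1).div_const 2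
  have h2 : HasDerivAt (fun t : ℝ => (t + 1) / 2) (1 / 2) t :=
    ((hasDerivAt_id t).add_const 1).div_const 2
  have h := ((h1.fun_pow m).mul (h2.fun_pow (n - m))).const_mul
    (genBinom (n + a) (n - m) * genBinom (n + b) m)
  refine h.congr_of_eventuallyEq (Filter.Eventually.of_forall fun s => ?_)
  change _ = genBinom (n + a) (n - m) * genBinom (n + b) m *
    (((s - 1) / 2) ^ m * ((s + 1) / 2) ^ (n - m))
  ring

theorem hasDerivAt_jacobiP_succ (n : ℕ) (a b t : ℝ) :
    HasDerivAt (jacobiP (n + 1) a b)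
      ((n + a + b + 2) / 2 * jacobiP n (a + 1) (b + 1) t) t := by
  convert hasDerivAt_jacobiP_sum (n + 1) a b t using 1
  simp only [mul_add, Finset.sum_add_distrib]
  rw [Finset.sum_range_succ' (n := n + 1), Finset.sum_range_succ (n := n + 1)]
  unfold jacobiP
  simp only [Nat.cast_zero, zero_mul, mul_zero, add_zero, Nat.sub_self]
  rw [← Finset.sum_add_distrib, Finset.mul_sum]
  apply Finset.sum_congr rfl
  intro m hm
  have hm' : m ≤ n := Nat.lt_succ_iff.mp (Finset.mem_range.mp hm)
  obtain ⟨k, rfl⟩ := Nat.exists_eq_add_of_le hm'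
  have e1 : m + k + 1 - (m + 1) = k := by omega
  have e2 : m + k + 1 - m = k + 1 := by omega
  have e3 : m + k - m = k := by omega
  rw [e1, e2, e3]
  simp only [Nat.add_sub_cancel]
  have r1 := succ_mul_genBinom_succ (((m + k + 1 : ℕ) : ℝ) + b) m
  have r2 := succ_mul_genBinom_succ (((m + k + 1 : ℕ) : ℝ) + a) k
  have c1 : ((m + k : ℕ) : ℝ) + (a + 1) = ((m + k + 1 : ℕ) : ℝ) + a := by push_cast; ring
  have c2 : ((m + k : ℕ) : ℝ) + (b + 1) = ((m + k + 1 : ℕ) : ℝ) + b := by push_cast; ring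
  rw [c1, c2]
  set A := genBinom (((m + k + 1 : ℕ) : ℝ) + a)
  set B := genBinom (((m + k + 1 : ℕ) : ℝ) + b)
  push_cast at r1 r2 ⊢
  linear_combination (-(1 / 2) * A k * ((t - 1) / 2) ^ m * ((t + 1) / 2) ^ k) * r1 -
    (1 / 2 * B m * ((t - 1) / 2) ^ m * ((t + 1) / 2) ^ k) * r2

/-- The first-order system satisfied by `P_{n+1}^{(a,b)}` and `P_n^{(a+1,b+1)}`. -/
theorem hasDerivAt_jacobiP_lower (n : ℕ) (a b t : ℝ) (ht : 1 - t ^ 2 ≠ 0) :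
    HasDerivAt (jacobiP n (a + 1) (b + 1))
      ((-2 * (n + 1) * jacobiP (n + 1) a b t -
        (b - a - (a + b + 2) * t) * jacobiP n (a + 1) (b + 1) t) / (1 - t ^ 2)) t := by
  convert hasDerivAt_jacobiP_sum n (a + 1) (b + 1) t using 1
  rw [div_eq_iff ht]
  unfold jacobiP
  have key : ∀ m ∈ Finset.range (n + 1 + 1),
      ((n : ℝ) + 1) * (genBinom ((n + 1 : ℕ) + a) (n + 1 - m) * genBinom ((n + 1 : ℕ) + b) m *
        ((t - 1) / 2) ^ m * ((t + 1) / 2) ^ (n + 1 - m)) =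
      (((n + 1 - m : ℕ) : ℝ) * genBinom ((n + 1 : ℕ) + a) (n + 1 - m)) *
        genBinom ((n + 1 : ℕ) + b) m * ((t - 1) / 2) ^ m * ((t + 1) / 2) ^ (n + 1 - m) +
      genBinom ((n + 1 : ℕ) + a) (n + 1 - m) * ((m : ℝ) * genBinom ((n + 1 : ℕ) + b) m) *
        ((t - 1) / 2) ^ m * ((t + 1) / 2) ^ (n + 1 - m) := by
    intro m hm
    have hm' : m ≤ n + 1 := Nat.lt_succ_iff.mp (Finset.mem_range.mp hm)
    rw [Nat.cast_sub hm']
    push_cast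
    ring
  rw [mul_assoc (-2 : ℝ), Finset.mul_sum _ _ ((n : ℝ) + 1), Finset.sum_congr rfl key,
    Finset.sum_add_distrib, Finset.sum_range_succ (n := n + 1),
    Finset.sum_range_succ' (n := n + 1)]
  simp only [Nat.cast_zero, zero_mul, mul_zero, add_zero, Nat.sub_self]
  rw [← Finset.sum_add_distrib, Finset.mul_sum, Finset.mul_sum, ← Finset.sum_sub_distrib,
    Finset.sum_mul]
  apply Finset.sum_congr rfl
  intro m hm
  have hm' : m ≤ n := Nat.lt_succ_iff.mp (Finset.mem_range.mp hm)
  obtain ⟨k, rfl⟩ := Nat.exists_eq_add_of_le hm'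
  have e1 : m + k + 1 - (m + 1) = k := by omega
  have e2 : m + k + 1 - m = k + 1 := by omega
  have e3 : m + k - m = k := by omega
  rw [e1, e2, e3]
  have r1 := succ_mul_genBinom_succ (((m + k + 1 : ℕ) : ℝ) + b) m
  have r2 := succ_mul_genBinom_succ (((m + k + 1 : ℕ) : ℝ) + a) k
  have c1 : ((m + k : ℕ) : ℝ) + (a + 1) = ((m + k + 1 : ℕ) : ℝ) + a := by push_cast; ring
  have c2 : ((m + k : ℕ) : ℝ) + (b + 1) = ((m + k + 1 : ℕ) : ℝ) + b := by push_cast; ring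
  rw [c1, c2]
  set A := genBinom (((m + k + 1 : ℕ) : ℝ) + a)
  set B := genBinom (((m + k + 1 : ℕ) : ℝ) + b)
  have p1 : (m : ℝ) * ((t - 1) / 2) ^ m = (m : ℝ) * ((t - 1) / 2) ^ (m - 1) * ((t - 1) / 2) := by
    rcases m with _ | m
    · simp
    · simp [pow_succ]; ring
  have p2 : (k : ℝ) * ((t + 1) / 2) ^ k = (k : ℝ) * ((t + 1) / 2) ^ (k - 1) * ((t + 1) / 2) := by
    rcases k with _ | k
    · simp
    · simp [pow_succ]; ring
  push_cast at r1 r2 ⊢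
  rw [r1, r2]
  simp only [pow_succ]
  generalize ((t - 1) / 2) ^ m = u at *
  generalize ((t + 1) / 2) ^ k = v at *
  linear_combination (-(A k) * B m * v * (t + 1)) * p1 -
    (A k * B m * u * (t - 1)) * p2

theorem jacobiP_neg (n : ℕ) (a b t : ℝ) :
    jacobiP n a b (-t) = (-1) ^ n * jacobiP n b a t := by
  unfold jacobiP
  rw [← Finset.sum_range_reflect, Finset.mul_sum]
  apply Finset.sum_congr rfl
  intro m hm
  have hm' : m ≤ n := Nat.lt_succ_iff.mp (Finset.mem_range.mp hm)
  have e1 : n + 1 - 1 - m = n - m := by omega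
  have e2 : n - (n - m) = m := by omega
  rw [e1, e2]
  have u1 : (-t - 1) / 2 = -1 * ((t + 1) / 2) := by ring
  have u2 : (-t + 1) / 2 = -1 * ((t - 1) / 2) := by ring
  have hn : ((-1 : ℝ)) ^ n = (-1) ^ (n - m) * (-1) ^ m := by rw [← pow_add]; congr 1; omega
  rw [u1, u2, mul_pow, mul_pow, hn]
  ring

theorem continuous_jacobiP (n : ℕ) (a b : ℝ) : Continuous (jacobiP n a b) :=
  continuous_iff_continuousAt.mpr fun t => (hasDerivAt_jacobiP_sum n a b t).continuousAt

theorem abs_one_add_le_exp_add_sq (x : ℝ) : |1 + x| ≤ exp (x + x ^ 2) := by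
  rcases le_or_gt (-1) x with h | h
  · rw [abs_of_nonneg (by linarith)]
    calc 1 + x ≤ exp x := by linarith [add_one_le_exp x]
      _ ≤ _ := exp_le_exp.mpr (by nlinarith [sq_nonneg x])
  · rw [abs_of_neg (by linarith)]
    have := add_one_le_exp (x + x ^ 2)
    nlinarith [sq_nonneg (x + 1)]

theorem abs_genBinom_le_choose_mul_exp (a : ℝ) (m k : ℕ) :
    |genBinom ((m + k : ℕ) + a) k| ≤ (Nat.choose (m + k) k : ℝ) *
      exp (a * ((harmonic (m + k) : ℝ) - harmonic m) +
        2 * a ^ 2 * (1 / ((m : ℝ) + 1) - 1 / ((m : ℝ) + k + 1))) := by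
  induction k with
  | zero => simp [genBinom]
  | succ k ih =>
    have hk : (0 : ℝ) < (k : ℝ) + 1 := by positivity
    have hj : (0 : ℝ) < (m : ℝ) + k + 1 := by positivity
    have e1 : genBinom ((m + (k + 1) : ℕ) + a) (k + 1) =
        genBinom ((m + k : ℕ) + a) k * (((m : ℝ) + k + 1) / (k + 1)) *
          (1 + a / ((m : ℝ) + k + 1)) := by
      unfold genBinom
      rw [Finset.prod_range_succ', Nat.factorial_succ]
      have hp : ∏ i ∈ Finset.range k, (((m + (k + 1) : ℕ) : ℝ) + a - ((i + 1 : ℕ) : ℝ)) =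
          ∏ i ∈ Finset.range k, (((m + k : ℕ) : ℝ) + a - (i : ℝ)) := by
        apply Finset.prod_congr rfl
        intro i _
        push_cast
        ring
      have hf : (Nat.factorial k : ℝ) ≠ 0 := by positivity
      rw [hp]
      push_cast
      field_simp
      ring
    have e2 : (Nat.choose (m + (k + 1)) (k + 1) : ℝ) =
        Nat.choose (m + k) k * (((m : ℝ) + k + 1) / (k + 1)) := by
      have h := Nat.add_one_mul_choose_eq (m + k) k
      have h' : ((m : ℝ) + k + 1) * Nat.choose (m + k) k =
          Nat.choose (m + (k + 1)) (k + 1) * ((k : ℝ) + 1) := by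
        rw [← add_assoc]
        exact_mod_cast h
      field_simp
      linarith
    have e3 : (harmonic (m + (k + 1)) : ℝ) = harmonic (m + k) + 1 / ((m : ℝ) + k + 1) := by
      rw [← add_assoc, harmonic_succ]
      push_cast
      rw [one_div]
    rw [e1, e2, e3, abs_mul, abs_mul, abs_of_pos (div_pos hj hk)]
    have h1 := abs_one_add_le_exp_add_sq (a / ((m : ℝ) + k + 1))
    have h2 : a / ((m : ℝ) + k + 1) + (a / ((m : ℝ) + k + 1)) ^ 2 ≤
        a * (1 / ((m : ℝ) + k + 1)) +
          2 * a ^ 2 * (1 / ((m : ℝ) + k + 1) - 1 / ((m : ℝ) + (k + 1 : ℕ) + 1)) := by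
      have h3 : (a / ((m : ℝ) + k + 1)) ^ 2 ≤
          2 * a ^ 2 * (1 / ((m : ℝ) + k + 1) - 1 / ((m : ℝ) + (k + 1 : ℕ) + 1)) := by
        have hj1 : (1 : ℝ) ≤ (m : ℝ) + k + 1 := by
          have : (0 : ℝ) ≤ (m : ℝ) + k := by positivity
          linarith
        have e4 : (m : ℝ) + (k + 1 : ℕ) + 1 = ((m : ℝ) + k + 1) + 1 := by push_cast; ring
        rw [e4]
        generalize (m : ℝ) + k + 1 = j at *
        have e5 : 1 / j - 1 / (j + 1) = 1 / (j * (j + 1)) := by field_simp; ring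
        rw [e5, div_pow, div_eq_mul_one_div (a ^ 2), mul_comm 2, mul_assoc]
        apply mul_le_mul_of_nonneg_left _ (sq_nonneg a)
        rw [mul_one_div, div_le_div_iff₀ (by positivity) (by positivity)]
        nlinarith
      rw [mul_one_div]
      linarith
    calc |genBinom ((m + k : ℕ) + a) k| * (((m : ℝ) + k + 1) / (k + 1)) *
          |1 + a / ((m : ℝ) + k + 1)|
        ≤ ((Nat.choose (m + k) k : ℝ) * exp (a * ((harmonic (m + k) : ℝ) - harmonic m) +
            2 * a ^ 2 * (1 / ((m : ℝ) + 1) - 1 / ((m : ℝ) + k + 1)))) *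
            (((m : ℝ) + k + 1) / (k + 1)) *
            exp (a * (1 / ((m : ℝ) + k + 1)) +
              2 * a ^ 2 * (1 / ((m : ℝ) + k + 1) - 1 / ((m : ℝ) + (k + 1 : ℕ) + 1))) := by
          gcongr
          exact h1.trans (exp_le_exp.mpr h2)
      _ = _ := by
          rw [show a * ((harmonic (m + k) : ℝ) + 1 / ((m : ℝ) + k + 1) - harmonic m) +
              2 * a ^ 2 * (1 / ((m : ℝ) + 1) - 1 / ((m : ℝ) + (k + 1 : ℕ) + 1)) =
            (a * ((harmonic (m + k) : ℝ) - harmonic m) +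
              2 * a ^ 2 * (1 / ((m : ℝ) + 1) - 1 / ((m : ℝ) + k + 1))) +
            (a * (1 / ((m : ℝ) + k + 1)) +
              2 * a ^ 2 * (1 / ((m : ℝ) + k + 1) - 1 / ((m : ℝ) + (k + 1 : ℕ) + 1))) by ring,
            exp_add (a * ((harmonic (m + k) : ℝ) - harmonic m) +
              2 * a ^ 2 * (1 / ((m : ℝ) + 1) - 1 / ((m : ℝ) + k + 1)))]
          ring

theorem harmonic_le_self (m : ℕ) : (harmonic m : ℝ) ≤ m := by
  induction m with
  | zero => simp
  | succ m ih =>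
    rw [harmonic_succ]
    push_cast
    have : ((m : ℝ) + 1)⁻¹ ≤ 1 := inv_le_one_of_one_le₀ (by linarith [Nat.cast_nonneg (α := ℝ) m])
    linarith

theorem abs_harmonic_sub_log_le_one (n : ℕ) (hn : 1 ≤ n) :
    |(harmonic n : ℝ) - log n| ≤ 1 := by
  have h1 := log_add_one_le_harmonic n
  have h2 := harmonic_le_one_add_log n
  have h3 : log n ≤ log (n + 1 : ℕ) :=
    log_le_log (by exact_mod_cast hn) (by push_cast; linarith)
  rw [abs_le]
  constructor <;> linarith

theorem abs_genBinom_sub_le (a : ℝ) (n m : ℕ) (hn : 1 ≤ n) (hm : m ≤ n) :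
    |genBinom (n + a) (n - m)| ≤ (n : ℝ) ^ m / (Nat.factorial m) *
      ((n : ℝ) ^ a * (exp (|a| + 2 * a ^ 2) * exp |a| ^ m)) := by
  obtain ⟨k, rfl⟩ := Nat.exists_eq_add_of_le hm
  rw [Nat.add_sub_cancel_left]
  have hpos : (0 : ℝ) < ((m + k : ℕ) : ℝ) := by exact_mod_cast hn
  refine (abs_genBinom_le_choose_mul_exp a m k).trans ?_
  apply mul_le_mul _ _ (by positivity) (by positivity)
  · have h := Nat.choose_le_pow_div (α := ℝ) m (m + k)
    rw [Nat.choose_symm_add] at h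
    exact h
  · rw [rpow_def_of_pos hpos, ← exp_nat_mul, ← exp_add, ← exp_add, exp_le_exp]
    have h1 := abs_harmonic_sub_log_le_one (m + k) hn
    have h2 : a * ((harmonic (m + k) : ℝ) - log (m + k : ℕ)) ≤ |a| := by
      refine (le_abs_self _).trans ?_
      rw [abs_mul]
      exact mul_le_of_le_one_right (abs_nonneg a) h1
    have h3 : -(a * (harmonic m : ℝ)) ≤ |a| * m := by
      refine (neg_le_abs _).trans ?_
      rw [abs_mul]
      apply mul_le_mul_of_nonneg_left _ (abs_nonneg a)
      rw [abs_of_nonneg]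
      · exact harmonic_le_self m
      · exact_mod_cast (by unfold harmonic; positivity : (0 : ℚ) ≤ harmonic m)
    have h4 : 2 * a ^ 2 * (1 / ((m : ℝ) + 1) - 1 / ((m : ℝ) + k + 1)) ≤ 2 * a ^ 2 * 1 := by
      apply mul_le_mul_of_nonneg_left _ (by positivity)
      have h5 : 1 / ((m : ℝ) + 1) ≤ 1 := by
        rw [div_le_one (by positivity)]
        linarith [Nat.cast_nonneg (α := ℝ) m]
      have h6 : 0 ≤ 1 / ((m : ℝ) + k + 1) := by positivity
      linarith
    nlinarith

theorem abs_genBinom_le (b : ℝ) (n m : ℕ) (hn : 1 ≤ n) (hm : m ≤ n) :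
    |genBinom (n + b) m| ≤ ((1 + |b|) * n) ^ m / (Nat.factorial m) := by
  unfold genBinom
  rw [abs_div, Nat.abs_cast, Finset.abs_prod]
  gcongr
  calc ∏ i ∈ Finset.range m, |(n : ℝ) + b - i| ≤ ∏ _i ∈ Finset.range m, ((1 + |b|) * n) := by
        apply Finset.prod_le_prod
        · intros; positivity
        · intro i hi
          have h1 : (i : ℝ) ≤ n := by
            exact_mod_cast ((Finset.mem_range.mp hi).le.trans hm)
          have h2 : (1 : ℝ) ≤ n := by exact_mod_cast hn
          have h3 : |(n : ℝ) + b - i| ≤ |(n : ℝ) - i| + |b| := by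
            rw [show (n : ℝ) + b - i = (n - i) + b by ring]
            exact abs_add_le _ _
          rw [abs_of_nonneg (by linarith : (0 : ℝ) ≤ n - i)] at h3
          nlinarith [abs_nonneg b, Nat.cast_nonneg (α := ℝ) i]
    _ = _ := by simp

theorem abs_jacobiP_le_near_one (a b c : ℝ) :
    ∃ C : ℝ, 0 < C ∧ ∀ n : ℕ, 1 ≤ n → ∀ t : ℝ, -1 ≤ t → t ≤ 1 →
      (n : ℝ) ^ 2 * (1 - t) ≤ c → |jacobiP n a b t| ≤ C * (n : ℝ) ^ a := by
  refine ⟨exp (|a| + 2 * a ^ 2) * exp (exp |a| * (1 + |b|) * c), by positivity, ?_⟩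
  intro n hn t ht0 ht1 hc
  have hn' : (0 : ℝ) < n := by exact_mod_cast hn
  set X : ℝ := exp |a| * (1 + |b|) * ((n : ℝ) ^ 2 * (1 - t)) with hX
  have hX0 : 0 ≤ X := by
    have : 0 ≤ 1 - t := by linarith
    positivity
  have hXc : X ≤ exp |a| * (1 + |b|) * c := by
    rw [hX]
    gcongr
  have hterm : ∀ m ∈ Finset.range (n + 1),
      |genBinom (n + a) (n - m) * genBinom (n + b) m * ((t - 1) / 2) ^ m *
        ((t + 1) / 2) ^ (n - m)| ≤
      (n : ℝ) ^ a * exp (|a| + 2 * a ^ 2) * (X ^ m / (Nat.factorial m)) := by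
    intro m hm
    have hm' : m ≤ n := Nat.lt_succ_iff.mp (Finset.mem_range.mp hm)
    have h1 := abs_genBinom_sub_le a n m hn hm'
    have h2 := abs_genBinom_le b n m hn hm'
    have h3 : |(t - 1) / 2| ^ m ≤ (1 - t) ^ m := by
      gcongr
      rw [abs_le]
      constructor <;> linarith
    have h4 : |(t + 1) / 2| ^ (n - m) ≤ 1 := by
      apply pow_le_one₀ (abs_nonneg _)
      rw [abs_le]
      constructor <;> linarith
    have hf : (1 : ℝ) ≤ Nat.factorial m := by exact_mod_cast Nat.factorial_pos m
    have h5 : ((1 + |b|) * n) ^ m / (Nat.factorial m : ℝ) ≤ ((1 + |b|) * n) ^ m :=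
      div_le_self (by positivity) hf
    have ht' : 0 ≤ 1 - t := by linarith
    rw [abs_mul, abs_mul, abs_mul, abs_pow, abs_pow]
    calc _ ≤ ((n : ℝ) ^ m / (Nat.factorial m) *
          ((n : ℝ) ^ a * (exp (|a| + 2 * a ^ 2) * exp |a| ^ m))) * ((1 + |b|) * n) ^ m *
          (1 - t) ^ m * 1 := by
          gcongr
          exact h2.trans h5
      _ = _ := by
          rw [hX]
          simp only [mul_pow]
          ring
  unfold jacobiP
  calc _ ≤ ∑ m ∈ Finset.range (n + 1),
        (n : ℝ) ^ a * exp (|a| + 2 * a ^ 2) * (X ^ m / (Nat.factorial m)) :=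
        (Finset.abs_sum_le_sum_abs _ _).trans (Finset.sum_le_sum hterm)
    _ = (n : ℝ) ^ a * exp (|a| + 2 * a ^ 2) *
        ∑ m ∈ Finset.range (n + 1), X ^ m / (Nat.factorial m) := by rw [Finset.mul_sum]
    _ ≤ (n : ℝ) ^ a * exp (|a| + 2 * a ^ 2) * exp X := by
        gcongr
        exact sum_le_exp_of_nonneg hX0 _
    _ ≤ (n : ℝ) ^ a * exp (|a| + 2 * a ^ 2) * exp (exp |a| * (1 + |b|) * c) := by
        gcongr
    _ = _ := by ring

/-- A weighted quadratic form in `P_{n+1}^{(a,b)}` and its derivative that is almost constant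
away from the endpoints. -/
noncomputable def jacobiEnergy (n : ℕ) (a b t : ℝ) : ℝ :=
  (1 - t) ^ (a + 1 / 2) * (1 + t) ^ (b + 1 / 2) *
    ((n + 1) * jacobiP (n + 1) a b t ^ 2 -
      (a - b + (a + b + 1) * t) / 2 * jacobiP (n + 1) a b t * jacobiP n (a + 1) (b + 1) t +
      (n + a + b + 2) / 4 * (1 - t ^ 2) * jacobiP n (a + 1) (b + 1) t ^ 2)

theorem hasDerivAt_jacobiEnergy (n : ℕ) (a b t : ℝ) (h0 : -1 < t) (h1 : t < 1) :
    HasDerivAt (jacobiEnergy n a b)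
      (-((1 - t) ^ (a + 1 / 2) * (1 + t) ^ (b + 1 / 2)) *
        (jacobiP (n + 1) a b t * jacobiP n (a + 1) (b + 1) t) *
        ((a + b + 1 + (a - b) * t) / (2 * (1 - t ^ 2)))) t := by
  have p1 : 0 < 1 - t := by linarith
  have p2 : 0 < 1 + t := by linarith
  have p3 : 1 - t ^ 2 ≠ 0 := by
    rw [show 1 - t ^ 2 = (1 - t) * (1 + t) by ring]
    positivity
  have hP := hasDerivAt_jacobiP_succ n a b t
  have hQ := hasDerivAt_jacobiP_lower n a b t p3
  have w1 : HasDerivAt (fun s : ℝ => (1 - s) ^ (a + 1 / 2))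
      (-(a + 1 / 2) * (1 - t) ^ (a + 1 / 2) / (1 - t)) t := by
    have h := ((hasDerivAt_id t).const_sub 1).rpow_const (p := a + 1 / 2) (Or.inl p1.ne')
    refine h.congr_deriv ?_
    rw [id_eq, rpow_sub_one p1.ne']
    ring
  have w2 : HasDerivAt (fun s : ℝ => (1 + s) ^ (b + 1 / 2))
      ((b + 1 / 2) * (1 + t) ^ (b + 1 / 2) / (1 + t)) t := by
    have h := ((hasDerivAt_id t).const_add 1).rpow_const (p := b + 1 / 2) (Or.inl p2.ne')
    refine h.congr_deriv ?_
    rw [id_eq, rpow_sub_one p2.ne']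
    ring
  have hg : HasDerivAt (fun s : ℝ => (a - b + (a + b + 1) * s) / 2) ((a + b + 1) / 2) t := by
    have h := (((hasDerivAt_id t).const_mul (a + b + 1)).const_add (a - b)).div_const 2
    simpa using h
  have hq : HasDerivAt (fun s : ℝ => ((n : ℝ) + a + b + 2) / 4 * (1 - s ^ 2))
      (((n : ℝ) + a + b + 2) / 4 * (-(2 * t))) t := by
    have h := (((hasDerivAt_pow 2 t).const_sub 1).const_mul (((n : ℝ) + a + b + 2) / 4))
    simpa using h
  have h := (w1.mul w2).mul ((((hP.pow 2).const_mul ((n : ℝ) + 1)).sub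
    ((hg.mul hP).mul hQ)).add (hq.mul (hQ.pow 2)))
  refine HasDerivAt.congr_deriv (f := jacobiEnergy n a b) h ?_
  simp only [Pi.mul_apply, Pi.pow_apply, Pi.add_apply, Pi.sub_apply]
  set P := jacobiP (n + 1) a b t
  set Q := jacobiP n (a + 1) (b + 1) t
  set u := (1 - t) ^ (a + 1 / 2)
  set v := (1 + t) ^ (b + 1 / 2)
  rw [show 1 - t ^ 2 = (1 - t) * (1 + t) by ring]
  push_cast
  field_simp
  ring

/-- Elementary bounds for the quadratic form in `jacobiEnergy`. -/
theorem energy_form_bounds {ν N G y z P Q g : ℝ} (hν : 0 < ν) (hN : ν / 2 ≤ N) (hy : 0 < y)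
    (hz : y ≤ z) (hg : |g| ≤ G) (hG : 4 * G ≤ ν * √y) :
    |P * Q| * (ν * √y) ≤ 4 * (ν * P ^ 2 - g * P * Q + N / 4 * z * Q ^ 2) ∧
    ν * P ^ 2 + N / 4 * z * Q ^ 2 ≤ 2 * (ν * P ^ 2 - g * P * Q + N / 4 * z * Q ^ 2) ∧
    ν * P ^ 2 - g * P * Q + N / 4 * z * Q ^ 2 ≤ 2 * (ν * P ^ 2 + N / 4 * z * Q ^ 2) := by
  have hs : 0 < √y := sqrt_pos.mpr hy
  have hsq : √y ^ 2 = y := sq_sqrt hy.le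
  have h1 : ν / 2 / 4 * y * Q ^ 2 ≤ N / 4 * z * Q ^ 2 := by
    have : 0 ≤ N := by linarith
    gcongr
  have h2 : |P * Q| * (ν * √y) ≤ 2 * (ν * P ^ 2 + N / 4 * z * Q ^ 2) := by
    have h3 : |P * Q| * (ν * √y) ≤ 2 * (ν * P ^ 2 + ν / 2 / 4 * y * Q ^ 2) := by
      have h4 : 0 ≤ ν * ((√y * |Q| / 2 - |P|) ^ 2 + |P| ^ 2) := by positivity
      have h5 : ν * ((√y * |Q| / 2 - |P|) ^ 2 + |P| ^ 2) =
          2 * (ν * |P| ^ 2 + ν / 2 / 4 * √y ^ 2 * |Q| ^ 2) - |P| * |Q| * (ν * √y) := by ring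
      rw [abs_mul, ← sq_abs P, ← sq_abs Q]
      rw [hsq] at h5
      linarith
    linarith
  have h6 : |g * P * Q| ≤ (ν * P ^ 2 + N / 4 * z * Q ^ 2) / 2 := by
    rw [mul_assoc, abs_mul]
    have h7 : |g| * |P * Q| ≤ ν * √y / 4 * |P * Q| := by
      gcongr
      linarith
    linarith
  have h8 := abs_le.mp h6
  refine ⟨?_, ?_, ?_⟩ <;> linarith

theorem jacobiEnergy_le_mul_exp (n : ℕ) (a b t₀ t₁ G : ℝ) (h0 : 0 ≤ t₀) (h01 : t₀ ≤ t₁)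
    (h1 : t₁ < 1) (hGab : G = |a - b| + |a + b + 1|)
    (hN : ((n : ℝ) + 1) / 2 ≤ n + a + b + 2) (hG : 4 * G ≤ ((n : ℝ) + 1) * √(1 - t₁)) :
    jacobiEnergy n a b t₀ ≤
      jacobiEnergy n a b t₁ * exp (4 * G / (n + 1) * (1 / √(1 - t₁))) := by
  set ν : ℝ := (n : ℝ) + 1 with hν
  have hν0 : 0 < ν := by positivity
  have hG0 : 0 ≤ G := by rw [hGab]; positivity
  have hform : ∀ t, t₀ ≤ t → t ≤ t₁ → _ := fun t ht0 ht1 =>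
    energy_form_bounds (P := jacobiP (n + 1) a b t) (Q := jacobiP n (a + 1) (b + 1) t)
      (g := (a - b + (a + b + 1) * t) / 2) (z := 1 - t ^ 2) hν0 hN
      (by linarith : 0 < 1 - t) (by nlinarith)
      (by
        rw [hGab, abs_le]
        have e1 := abs_le.mp (le_refl |a - b|)
        have e2 := abs_le.mp (le_refl |a + b + 1|)
        constructor <;> nlinarith [abs_nonneg (a - b), abs_nonneg (a + b + 1)] : _ ≤ G)
      (hG.trans (by gcongr))
  have hderiv : ∀ t, t₀ ≤ t → t ≤ t₁ →
      HasDerivAt (fun t => jacobiEnergy n a b t * exp (4 * G / ν * (1 / √(1 - t))))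
        (-((1 - t) ^ (a + 1 / 2) * (1 + t) ^ (b + 1 / 2)) *
        (jacobiP (n + 1) a b t * jacobiP n (a + 1) (b + 1) t) *
        ((a + b + 1 + (a - b) * t) / (2 * (1 - t ^ 2))) * exp (4 * G / ν * (1 / √(1 - t))) +
        jacobiEnergy n a b t * (exp (4 * G / ν * (1 / √(1 - t))) *
          (4 * G / ν * (1 / (2 * ((1 - t) * √(1 - t))))))) t := by
    intro t ht0 ht1
    have p1 : 0 < 1 - t := by linarith
    have hs : √(1 - t) ≠ 0 := (sqrt_pos.mpr p1).ne'
    have d1 : HasDerivAt (fun t : ℝ => 1 / √(1 - t)) (1 / (2 * ((1 - t) * √(1 - t)))) t := by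
      have h := (((hasDerivAt_id t).const_sub 1).sqrt p1.ne').fun_inv hs
      simp only [id, sq_sqrt p1.le, ← one_div] at h
      refine h.congr_deriv ?_
      field_simp
    exact (hasDerivAt_jacobiEnergy n a b t (by linarith) (by linarith)).mul
      ((d1.const_mul (4 * G / ν)).exp)
  have hmono : MonotoneOn (fun t => jacobiEnergy n a b t * exp (4 * G / ν * (1 / √(1 - t))))
      (Set.Icc t₀ t₁) := by
    apply monotoneOn_of_hasDerivWithinAt_nonneg (convex_Icc t₀ t₁)
      (fun t ht => (hderiv t ht.1 ht.2).continuousAt.continuousWithinAt)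
      (fun t ht => (hderiv t (interior_subset ht).1 (interior_subset ht).2).hasDerivWithinAt)
    intro t ht
    obtain ⟨ht0, ht1⟩ := interior_subset ht
    have p1 : 0 < 1 - t := by linarith
    have p2 : 0 < 1 + t := by linarith
    have hs : 0 < √(1 - t) := sqrt_pos.mpr p1
    have hf := (hform t ht0 ht1).1
    unfold jacobiEnergy
    set P := jacobiP (n + 1) a b t
    set Q := jacobiP n (a + 1) (b + 1) t
    have hw : 0 < (1 - t) ^ (a + 1 / 2) * (1 + t) ^ (b + 1 / 2) := by positivity
    set w := (1 - t) ^ (a + 1 / 2) * (1 + t) ^ (b + 1 / 2)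
    set F := (ν * P ^ 2 - (a - b + (a + b + 1) * t) / 2 * P * Q +
      (↑n + a + b + 2) / 4 * (1 - t ^ 2) * Q ^ 2) with hF
    have hF0 : 0 ≤ F := by
      have : 0 ≤ |P * Q| * (ν * √(1 - t)) := by positivity
      linarith
    have k1 : |(a + b + 1 + (a - b) * t) / (2 * (1 - t ^ 2))| ≤ G / (2 * (1 - t)) := by
      rw [abs_div, abs_of_pos (by nlinarith : 0 < 2 * (1 - t ^ 2))]
      apply div_le_div₀ hG0 _ (by positivity) (by nlinarith)
      rw [hGab]
      refine (abs_add_le _ _).trans ?_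
      rw [abs_mul, abs_of_nonneg (by linarith : 0 ≤ t)]
      nlinarith [abs_nonneg (a - b)]
    have k2 : |P * Q * ((a + b + 1 + (a - b) * t) / (2 * (1 - t ^ 2)))| ≤
        F * (4 * G / ν * (1 / (2 * ((1 - t) * √(1 - t))))) := by
      rw [abs_mul]
      calc _ ≤ (4 * F / (ν * √(1 - t))) * (G / (2 * (1 - t))) := by
            gcongr
            rw [le_div_iff₀ (by positivity)]
            exact hf
        _ = _ := by field_simp
    have k3 := (abs_le.mp k2).2
    have : 0 ≤ w * exp (4 * G / ν * (1 / √(1 - t))) *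
        (F * (4 * G / ν * (1 / (2 * ((1 - t) * √(1 - t))))) -
          P * Q * ((a + b + 1 + (a - b) * t) / (2 * (1 - t ^ 2)))) :=
      mul_nonneg (by positivity) (by linarith)
    calc 0 ≤ _ := this
      _ = _ := by ring
  have h := hmono (Set.left_mem_Icc.mpr h01) (Set.right_mem_Icc.mpr h01) h01
  refine le_trans ?_ h
  have hE0 : 0 ≤ jacobiEnergy n a b t₀ := by
    have hf := (hform t₀ le_rfl h01).1
    unfold jacobiEnergy
    apply mul_nonneg
    · have p1 : 0 < 1 - t₀ := by linarith
      positivity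
    · have : 0 ≤ |jacobiP (n + 1) a b t₀ * jacobiP n (a + 1) (b + 1) t₀| * (ν * √(1 - t₀)) := by
        positivity
      linarith
  exact le_mul_of_one_le_right hE0 (one_le_exp (by positivity))

/-- The factor `1 + N √(1 - |y|)` measuring the distance of `y` to the endpoints. -/
noncomputable def endpointScale (N y : ℝ) : ℝ := 1 + N * √(1 - |y|)

theorem one_le_endpointScale {N : ℝ} (hN : 0 ≤ N) (y : ℝ) : 1 ≤ endpointScale N y := by
  unfold endpointScale
  have : 0 ≤ N * √(1 - |y|) := by positivity
  linarith

theorem rpow_le_mul_rpow_of_comparable {x y K : ℝ} (p : ℝ) (hx : 0 < x) (hy : 0 < y)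
    (hxy : x ≤ K * y) (hyx : y ≤ K * x) : x ^ p ≤ K ^ |p| * y ^ p := by
  have hK : 0 < K := by
    by_contra h
    nlinarith
  rcases le_total 0 p with hp | hp
  · rw [abs_of_nonneg hp, ← mul_rpow hK.le hy.le]
    exact rpow_le_rpow hx.le hxy hp
  · rw [abs_of_nonpos hp, rpow_neg hK.le, ← div_eq_inv_mul, ← div_rpow hy.le hK.le]
    apply rpow_le_rpow_of_nonpos (by positivity) _ hp
    rw [div_le_iff₀ hK]
    linarith

theorem energy_bound_of_endpoint_bounds {ν r N z v V P Q X R C D F : ℝ} (hν : 0 < ν) (hX : 0 < X)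
    (hR : 0 ≤ R) (hv : 0 ≤ v) (hvV : v ≤ V) (hN : N ≤ 2 * ν) (hz0 : 0 ≤ z)
    (hz : z ≤ 2 * (r ^ 2 / ν ^ 2)) (hP : |P| ≤ C * X) (hQ : |Q| ≤ D * (X * ν))
    (hF : F ≤ 2 * (ν * P ^ 2 + N / 4 * z * Q ^ 2)) :
    R * (X ^ 2 * ν)⁻¹ * v * F ≤ R * V * (2 * (C ^ 2 + r ^ 2 * D ^ 2)) := by
  have hP2 : P ^ 2 ≤ (C * X) ^ 2 := by
    rw [← sq_abs]
    gcongr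
  have hQ2 : Q ^ 2 ≤ (D * (X * ν)) ^ 2 := by
    rw [← sq_abs]
    gcongr
  have hform : ν * P ^ 2 + N / 4 * z * Q ^ 2 ≤ (C ^ 2 + r ^ 2 * D ^ 2) * (X ^ 2 * ν) := by
    calc _ ≤ ν * (C * X) ^ 2 + (2 * ν) / 4 * (2 * (r ^ 2 / ν ^ 2)) * (D * (X * ν)) ^ 2 := by
          gcongr
      _ = _ := by
          field_simp
          ring
  calc _ ≤ R * (X ^ 2 * ν)⁻¹ * v * (2 * ((C ^ 2 + r ^ 2 * D ^ 2) * (X ^ 2 * ν))) := by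
        gcongr
        linarith
    _ = R * v * (2 * (C ^ 2 + r ^ 2 * D ^ 2)) := by field_simp
    _ ≤ _ := by gcongr

theorem weighted_sq_le_energy {u v V A B F : ℝ} (hu : 0 ≤ u) (hv : 1 ≤ V * v) (hA : 0 ≤ A)
    (hB : 0 ≤ B) (hF : A + B ≤ 2 * F) : A * u ≤ V * 2 * (u * v * F) := by
  have hV : 0 ≤ V * v := by linarith
  calc A * u = u * 1 * A := by ring
    _ ≤ u * (V * v) * (2 * F) := by
        gcongr
        linarith
    _ = _ := by ring

theorem one_sub_sq_bounds {s : ℝ} (h0 : 0 ≤ s) (h1 : s ≤ 1) :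
    1 - s ≤ 1 - s ^ 2 ∧ 1 - s ^ 2 ≤ 2 * (1 - s) ∧ 0 ≤ 1 - s ^ 2 := by
  refine ⟨?_, ?_, ?_⟩ <;> nlinarith

set_option maxHeartbeats 1000000 in
theorem jacobiP_sq_le_away (a b : ℝ) :
    ∃ r C : ℝ, 1 ≤ r ∧ 0 < C ∧ ∀ n : ℕ, ∀ t : ℝ, 0 ≤ t →
      r ^ 2 ≤ ((n : ℝ) + 1) ^ 2 * (1 - t) →
      ((n : ℝ) + 1) * jacobiP (n + 1) a b t ^ 2 * (1 - t) ^ (a + 1 / 2) ≤ C := by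
  set G : ℝ := |a - b| + |a + b + 1| with hG
  have hG0 : 0 ≤ G := by positivity
  set r : ℝ := 4 * G + 2 * |a + b + 1| + 2 with hr
  have hab0 := abs_nonneg (a + b + 1)
  have hr2 : 2 ≤ r := by linarith
  obtain ⟨C₁, hC₁, h₁⟩ := abs_jacobiP_le_near_one a b (r ^ 2)
  obtain ⟨C₂, hC₂, h₂⟩ := abs_jacobiP_le_near_one (a + 1) (b + 1) (r ^ 2)
  refine ⟨r, 2 ^ |b + 1 / 2| * 2 * ((r ^ 2) ^ (a + 1 / 2) * 2 ^ |b + 1 / 2| *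
    (2 * (C₁ ^ 2 + r ^ 2 * (C₂ * 2 ^ |a + 1|) ^ 2)) * exp 1), by linarith, by positivity, ?_⟩
  intro n t ht0 hrt
  have hncast : ((n + 1 : ℕ) : ℝ) = (n : ℝ) + 1 := by push_cast; ring
  have hn0 : (0 : ℝ) ≤ n := Nat.cast_nonneg n
  set ν : ℝ := (n : ℝ) + 1 with hν
  have hν0 : 0 < ν := by positivity
  have hrν : r ≤ ν := by
    apply le_of_sq_le_sq _ hν0.le
    nlinarith [sq_nonneg ν]
  have hn1 : 1 ≤ n := by
    have : (1 : ℝ) ≤ n := by linarith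
    exact_mod_cast this
  set t₁ : ℝ := 1 - (r / ν) ^ 2 with ht₁
  have hrν0 : 0 < r / ν := by positivity
  have hrν1 : (r / ν) ^ 2 ≤ 1 := by
    apply pow_le_one₀ hrν0.le
    rw [div_le_one hν0]
    exact hrν
  have ht₁0 : 0 ≤ t₁ := by linarith
  have hsq : (r / ν) ^ 2 = r ^ 2 / ν ^ 2 := div_pow _ _ _
  have htt : t ≤ t₁ := by
    rw [ht₁, hsq]
    have : r ^ 2 / ν ^ 2 ≤ 1 - t := by
      rw [div_le_iff₀ (by positivity)]
      linarith
    linarith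
  have ht₁1 : t₁ < 1 := by
    have : 0 < (r / ν) ^ 2 := by positivity
    linarith
  have e1 : 1 - t₁ = (r / ν) ^ 2 := by rw [ht₁]; ring
  have es : √(1 - t₁) = r / ν := by rw [e1, sqrt_sq hrν0.le]
  have hN : ν / 2 ≤ n + a + b + 2 := by
    have := neg_abs_le (a + b + 1)
    linarith
  have hN2 : n + a + b + 2 ≤ 2 * ν := by
    have := le_abs_self (a + b + 1)
    linarith
  have hG4 : 4 * G ≤ ν * √(1 - t₁) := by
    rw [es, mul_div_cancel₀ _ hν0.ne']
    linarith
  have hgbound : ∀ s, 0 ≤ s → s ≤ 1 → |(a - b + (a + b + 1) * s) / 2| ≤ G := by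
    intro s hs0 hs1
    rw [hG, abs_le]
    have e1 := abs_le.mp (le_refl |a - b|)
    have e2 := abs_le.mp (le_refl |a + b + 1|)
    constructor <;> nlinarith [abs_nonneg (a - b), abs_nonneg (a + b + 1)]
  have hmain := jacobiEnergy_le_mul_exp n a b t t₁ G ht0 htt ht₁1 hG hN hG4
  have hexp : exp (4 * G / ν * (1 / √(1 - t₁))) ≤ exp 1 := by
    rw [exp_le_exp, es]
    have : 4 * G / ν * (1 / (r / ν)) = 4 * G / r := by field_simp
    rw [this, div_le_one (by linarith)]
    linarith
  have hlow := (energy_form_bounds (P := jacobiP (n + 1) a b t)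
    (Q := jacobiP n (a + 1) (b + 1) t) (z := 1 - t ^ 2) hν0 hN (by linarith : 0 < 1 - t)
    (one_sub_sq_bounds ht0 (by linarith)).1 (hgbound t ht0 (by linarith))
    (hG4.trans (by gcongr))).2.1
  have hup := (energy_form_bounds (P := jacobiP (n + 1) a b t₁)
    (Q := jacobiP n (a + 1) (b + 1) t₁) (z := 1 - t₁ ^ 2) hν0 hN (by linarith : 0 < 1 - t₁)
    (one_sub_sq_bounds ht₁0 (by linarith)).1 (hgbound t₁ ht₁0 (by linarith)) hG4).2.2
  have hP₁ := h₁ (n + 1) (by omega) t₁ (by linarith) (by linarith) (by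
    rw [hncast, e1, hsq, mul_div_cancel₀ _ (by positivity)])
  have hQ₁ := h₂ n hn1 t₁ (by linarith) (by linarith) (by
    rw [e1, hsq, mul_div_assoc', div_le_iff₀ (by positivity), mul_comm]
    gcongr
    linarith)
  rw [hncast] at hP₁
  have hQ₂ : |jacobiP n (a + 1) (b + 1) t₁| ≤ C₂ * 2 ^ |a + 1| * (ν ^ a * ν) := by
    refine hQ₁.trans ?_
    rw [mul_assoc, ← rpow_add_one hν0.ne']
    have hn1' : (1 : ℝ) ≤ n := by exact_mod_cast hn1
    gcongr
    exact rpow_le_mul_rpow_of_comparable _ (by linarith) hν0 (by linarith) (by linarith)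
  have hw2 : ∀ s : ℝ, 0 ≤ s → s ≤ 1 → (1 + s) ^ (b + 1 / 2) ≤ (2 : ℝ) ^ |b + 1 / 2| ∧
      1 ≤ (2 : ℝ) ^ |b + 1 / 2| * (1 + s) ^ (b + 1 / 2) := by
    intro s hs0 hs1
    have a1 := rpow_le_mul_rpow_of_comparable (x := 1 + s) (y := 1) (K := 2) (b + 1 / 2)
      (by linarith) one_pos (by linarith) (by linarith)
    have a2 := rpow_le_mul_rpow_of_comparable (x := 1) (y := 1 + s) (K := 2) (b + 1 / 2)
      one_pos (by linarith) (by linarith) (by linarith)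
    rw [one_rpow] at a1 a2
    rw [mul_one] at a1
    exact ⟨a1, a2⟩
  have hE₁ : jacobiEnergy n a b t₁ ≤ (r ^ 2) ^ (a + 1 / 2) * 2 ^ |b + 1 / 2| *
      (2 * (C₁ ^ 2 + r ^ 2 * (C₂ * 2 ^ |a + 1|) ^ 2)) := by
    have hx : 0 < ν ^ a := by positivity
    have hwt : (1 - t₁) ^ (a + 1 / 2) = (r ^ 2) ^ (a + 1 / 2) * ((ν ^ a) ^ 2 * ν)⁻¹ := by
      rw [e1, hsq, div_rpow (by positivity) (by positivity), div_eq_mul_inv]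
      congr 2
      rw [← rpow_natCast ν 2, ← rpow_mul hν0.le, ← rpow_natCast (ν ^ a) 2, ← rpow_mul hν0.le,
        ← rpow_add_one hν0.ne']
      congr 1
      push_cast
      ring
    have hz : 1 - t₁ ^ 2 ≤ 2 * (r ^ 2 / ν ^ 2) := by
      rw [← hsq, ← e1]
      exact (one_sub_sq_bounds ht₁0 ht₁1.le).2.1
    have hz0 : 0 ≤ 1 - t₁ ^ 2 := (one_sub_sq_bounds ht₁0 ht₁1.le).2.2
    unfold jacobiEnergy
    rw [hwt]
    exact energy_bound_of_endpoint_bounds hν0 hx (by positivity)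
      (rpow_nonneg (by linarith) _) (hw2 t₁ ht₁0 ht₁1.le).1 hN2 hz0 hz hP₁ hQ₂ hup
  have hpt : 0 < 1 - t := by linarith
  have hE₀ : ν * jacobiP (n + 1) a b t ^ 2 * (1 - t) ^ (a + 1 / 2) ≤
      2 ^ |b + 1 / 2| * 2 * jacobiEnergy n a b t := by
    have hw := (hw2 t ht0 (by linarith)).2
    have hB : 0 ≤ (n + a + b + 2) / 4 * (1 - t ^ 2) * jacobiP n (a + 1) (b + 1) t ^ 2 := by
      have h0 : 0 ≤ 1 - t ^ 2 := (one_sub_sq_bounds ht0 (by linarith)).2.2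
      have h0' : 0 ≤ n + a + b + 2 := by linarith
      positivity
    exact weighted_sq_le_energy (rpow_nonneg hpt.le _) hw (by positivity) hB hlow
  calc _ ≤ _ := hE₀
    _ ≤ _ := by
      gcongr
      refine hmain.trans ?_
      gcongr

theorem abs_jacobiP_le_of_nonneg (a b : ℝ) :
    ∃ C : ℝ, 0 < C ∧ ∀ n : ℕ, 1 ≤ n → ∀ t : ℝ, 0 ≤ t → t ≤ 1 →
      |jacobiP n a b t| ≤ C * (n : ℝ) ^ a * endpointScale n t ^ (-a - 1 / 2) := by
  obtain ⟨r, C₁, hr, hC₁, h₁⟩ := jacobiP_sq_le_away a b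
  obtain ⟨C₂, hC₂, h₂⟩ := abs_jacobiP_le_near_one a b (r ^ 2)
  set p := -a - 1 / 2 with hp
  refine ⟨C₂ * (1 + r) ^ |p| + √C₁ * 2 ^ |p|, by positivity, ?_⟩
  intro n hn t ht0 ht1
  have hn' : (0 : ℝ) < n := by exact_mod_cast hn
  have hS1 := one_le_endpointScale hn'.le t
  rcases le_total ((n : ℝ) ^ 2 * (1 - t)) (r ^ 2) with h | h
  · have hS : endpointScale n t ≤ 1 + r := by
      unfold endpointScale
      rw [abs_of_nonneg ht0]
      have : (n : ℝ) * √(1 - t) ≤ r := by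
        apply le_of_sq_le_sq _ (by linarith)
        rw [mul_pow, sq_sqrt (by linarith)]
        exact h
      linarith
    have hc := rpow_le_mul_rpow_of_comparable (x := 1) (y := endpointScale n t) (K := 1 + r) p
      one_pos (by linarith) (by nlinarith) (by linarith)
    rw [one_rpow] at hc
    calc |jacobiP n a b t| ≤ C₂ * (n : ℝ) ^ a * 1 := by
          rw [mul_one]
          exact h₂ n hn t (by linarith) ht1 h
      _ ≤ C₂ * (n : ℝ) ^ a * ((1 + r) ^ |p| * endpointScale n t ^ p) := by gcongr
      _ = (C₂ * (1 + r) ^ |p|) * (n : ℝ) ^ a * endpointScale n t ^ p := by ring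
      _ ≤ _ := by
          gcongr
          have : 0 ≤ √C₁ * 2 ^ |p| := by positivity
          linarith
  · obtain ⟨k, rfl⟩ := Nat.exists_eq_add_of_le' hn
    have hcast : ((k + 1 : ℕ) : ℝ) = (k : ℝ) + 1 := by push_cast; ring
    rw [hcast] at h hn' hS1 ⊢
    have hk := h₁ k t ht0 h
    set ν : ℝ := (k : ℝ) + 1
    have ht : 0 < 1 - t := by
      by_contra hcon
      nlinarith [sq_nonneg ν]
    have hs : 0 < √(1 - t) := sqrt_pos.mpr ht
    set z := ν * √(1 - t) with hz
    have hz0 : 0 < z := by positivity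
    have hz1 : 1 ≤ z := by
      refine hr.trans (le_of_sq_le_sq ?_ hz0.le)
      rw [hz, mul_pow, sq_sqrt ht.le]
      exact h
    have hSz : endpointScale ν t = 1 + z := by
      unfold endpointScale
      rw [abs_of_nonneg ht0]
    have hc := rpow_le_mul_rpow_of_comparable (x := z) (y := endpointScale ν t) (K := 2) p
      hz0 (by linarith) (by linarith) (by linarith)
    have hP : |jacobiP (k + 1) a b t| ≤ √C₁ * (ν ^ a * z ^ p) := by
      apply abs_le_of_sq_le_sq _ (by positivity)
      rw [mul_pow, sq_sqrt hC₁.le]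
      have e : (ν ^ a * z ^ p) ^ 2 = ν⁻¹ * ((1 - t) ^ (a + 1 / 2))⁻¹ := by
        rw [hz, mul_rpow hn'.le hs.le, ← mul_assoc, ← rpow_add hn', mul_pow]
        congr 1
        · rw [← rpow_natCast (ν ^ (a + p)) 2, ← rpow_mul hn'.le, ← rpow_neg_one]
          congr 1
          rw [hp]
          push_cast
          ring
        · rw [← rpow_natCast _ 2, ← rpow_mul hs.le, mul_comm, rpow_mul hs.le, rpow_natCast,
            sq_sqrt ht.le, ← rpow_neg ht.le]
          congr 1
          rw [hp]
          ring
      rw [e]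
      have hx : 0 < (1 - t) ^ (a + 1 / 2) := by positivity
      rw [← mul_inv, ← div_eq_mul_inv, le_div_iff₀ (by positivity)]
      linarith
    calc |jacobiP (k + 1) a b t| ≤ √C₁ * (ν ^ a * z ^ p) := hP
      _ ≤ √C₁ * (ν ^ a * (2 ^ |p| * endpointScale ν t ^ p)) := by gcongr
      _ = (√C₁ * 2 ^ |p|) * ν ^ a * endpointScale ν t ^ p := by ring
      _ ≤ _ := by
          gcongr
          have : 0 ≤ C₂ * (1 + r) ^ |p| := by positivity
          linarith

theorem abs_jacobiP_le (a b : ℝ) (hab : b ≤ a) :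
    ∃ C : ℝ, 0 < C ∧ ∀ n : ℕ, 1 ≤ n → ∀ t : ℝ, |t| ≤ 1 →
      |jacobiP n a b t| ≤ C * (n : ℝ) ^ a * endpointScale n t ^ (-a - 1 / 2) := by
  obtain ⟨C₁, hC₁, h₁⟩ := abs_jacobiP_le_of_nonneg a b
  obtain ⟨C₂, hC₂, h₂⟩ := abs_jacobiP_le_of_nonneg b a
  refine ⟨C₁ + C₂ * 2 ^ (a - b), by positivity, ?_⟩
  intro n hn t ht
  have hn' : (1 : ℝ) ≤ n := by exact_mod_cast hn
  have hn0 : (0 : ℝ) < n := by linarith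
  have hS1 := one_le_endpointScale hn0.le t
  rcases le_total 0 t with h | h
  · calc _ ≤ C₁ * (n : ℝ) ^ a * endpointScale n t ^ (-a - 1 / 2) :=
          h₁ n hn t h (abs_le.mp ht).2
      _ ≤ _ := by
          gcongr
          have : 0 ≤ C₂ * 2 ^ (a - b) := by positivity
          linarith
  · have hb := h₂ n hn (-t) (by linarith) (by linarith [(abs_le.mp ht).1])
    have e1 : endpointScale n (-t) = endpointScale n t := by
      unfold endpointScale
      rw [abs_neg]
    have e2 : |jacobiP n a b t| = |jacobiP n b a (-t)| := by
      rw [jacobiP_neg, abs_mul, abs_pow, abs_neg, abs_one, one_pow, one_mul]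
    rw [e2]
    rw [e1] at hb
    have hS2 : endpointScale n t ≤ 2 * n := by
      unfold endpointScale
      have : √(1 - |t|) ≤ 1 := by
        rw [sqrt_le_one]
        linarith [abs_nonneg t]
      nlinarith
    have e3 : (n : ℝ) ^ b * endpointScale n t ^ (-b - 1 / 2) ≤
        2 ^ (a - b) * ((n : ℝ) ^ a * endpointScale n t ^ (-a - 1 / 2)) := by
      have k1 : endpointScale n t ^ (a - b) ≤ 2 ^ (a - b) * (n : ℝ) ^ (a - b) := by
        rw [← mul_rpow zero_le_two hn0.le]
        exact rpow_le_rpow (by linarith) hS2 (by linarith)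
      rw [show -b - 1 / 2 = (a - b) + (-a - 1 / 2) by ring, rpow_add (by linarith)]
      calc _ ≤ (n : ℝ) ^ b * ((2 ^ (a - b) * (n : ℝ) ^ (a - b)) *
            endpointScale n t ^ (-a - 1 / 2)) := by gcongr
        _ = 2 ^ (a - b) * (((n : ℝ) ^ b * (n : ℝ) ^ (a - b)) *
            endpointScale n t ^ (-a - 1 / 2)) := by ring
        _ = _ := by
          rw [← rpow_add hn0]
          congr 4
          ring
    calc _ ≤ C₂ * ((n : ℝ) ^ b * endpointScale n t ^ (-b - 1 / 2)) := by
          rw [← mul_assoc]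
          exact hb
      _ ≤ C₂ * (2 ^ (a - b) * ((n : ℝ) ^ a * endpointScale n t ^ (-a - 1 / 2))) := by gcongr
      _ = (C₂ * 2 ^ (a - b)) * (n : ℝ) ^ a * endpointScale n t ^ (-a - 1 / 2) := by ring
      _ ≤ _ := by
          gcongr
          linarith

/-- `G 0, G 1, …, G K` are successive antiderivatives satisfying, on `S`, the size bounds typical
of Jacobi polynomials of degree about `N`. -/
structure AntiderivBound (K : ℕ) (M σ N : ℝ) (S : Set ℝ) (G : ℕ → ℝ → ℝ) : Prop where
  continuous : ∀ k, Continuous (G k)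
  hasDerivAt : ∀ k < K, ∀ y, HasDerivAt (G (k + 1)) (G k y) y
  bound : ∀ k ≤ K, ∀ y ∈ S, |G k y| ≤ M / (N ^ 2) ^ k * endpointScale N y ^ (σ + k)

theorem AntiderivBound.mono {K K' : ℕ} {M M' σ N : ℝ} {S S' : Set ℝ} {G : ℕ → ℝ → ℝ}
    (hN : 0 ≤ N) (h : AntiderivBound K M σ N S G) (hM : M ≤ M') (hK : K' ≤ K) (hS : S' ⊆ S) :
    AntiderivBound K' M' σ N S' G where
  continuous := h.continuous
  hasDerivAt k hk y := h.hasDerivAt k (hk.trans_le hK) y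
  bound k hk y hy := by
    have h1 := one_le_endpointScale hN y
    refine (h.bound k (hk.trans hK) y (hS hy)).trans ?_
    gcongr

theorem exists_antiderivBound_of_continuous (f : ℝ → ℝ) (hf : Continuous f) (K : ℕ) (σ N : ℝ)
    (hN : 1 ≤ N) :
    ∃ M : ℝ, 0 < M ∧ ∃ G : ℕ → ℝ → ℝ, G 0 = f ∧ AntiderivBound K M σ N {y | |y| ≤ 1} G := by
  set I : (ℝ → ℝ) → ℝ → ℝ := fun g y => ∫ s in (0 : ℝ)..y, g s with hI
  set G : ℕ → ℝ → ℝ := fun k => I^[k] f with hG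
  have hsucc : ∀ k, G (k + 1) = I (G k) := fun k => Function.iterate_succ_apply' I k f
  have hderiv : ∀ g : ℝ → ℝ, Continuous g → ∀ y, HasDerivAt (I g) (g y) y := fun g hg y =>
    intervalIntegral.integral_hasDerivAt_right (hg.intervalIntegrable _ _)
      (hg.stronglyMeasurableAtFilter _ _) hg.continuousAt
  have hcont : ∀ k, Continuous (G k) := by
    intro k
    induction k with
    | zero => exact hf
    | succ k ih =>
      rw [hsucc]
      exact continuous_iff_continuousAt.mpr fun y => (hderiv _ ih y).continuousAt
  have hB : ∀ k, ∃ B : ℝ, 0 ≤ B ∧ ∀ y, |y| ≤ 1 → |G k y| ≤ B := by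
    intro k
    obtain ⟨B, hB⟩ := (isCompact_Icc (a := (-1 : ℝ)) (b := 1)).exists_bound_of_continuousOn
      (hcont k).continuousOn
    refine ⟨B, (norm_nonneg _).trans (hB 0 (by norm_num)), fun y hy => ?_⟩
    exact hB y (abs_le.mp hy)
  choose B hB0 hB using hB
  have hN0 : 0 ≤ N := by linarith
  refine ⟨1 + ∑ k ∈ Finset.range (K + 1), B k * (N ^ 2) ^ k * (1 + N) ^ |σ + k|, ?_, G, rfl,
    hcont, fun k _ y => by rw [hsucc]; exact hderiv _ (hcont k) y, ?_⟩
  · have : 0 ≤ ∑ k ∈ Finset.range (K + 1), B k * (N ^ 2) ^ k * (1 + N) ^ |σ + k| :=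
      Finset.sum_nonneg fun k _ => by have := hB0 k; positivity
    linarith
  · intro k hk y hy
    have hS1 := one_le_endpointScale hN0 y
    have hS2 : endpointScale N y ≤ 1 + N := by
      unfold endpointScale
      have : √(1 - |y|) ≤ 1 := by
        rw [sqrt_le_one]
        linarith [abs_nonneg y]
      nlinarith
    have hc := rpow_le_mul_rpow_of_comparable (x := 1) (y := endpointScale N y) (K := 1 + N)
      (σ + k) one_pos (by linarith) (by nlinarith) (by linarith)
    rw [one_rpow] at hc
    have hle : B k * (N ^ 2) ^ k * (1 + N) ^ |σ + k| ≤
        ∑ k ∈ Finset.range (K + 1), B k * (N ^ 2) ^ k * (1 + N) ^ |σ + k| :=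
      Finset.single_le_sum (f := fun k : ℕ => B k * (N ^ 2) ^ k * (1 + N) ^ |σ + k|)
        (fun k _ => by have := hB0 k; positivity) (Finset.mem_range.mpr (by omega))
    have hNk : 0 < (N ^ 2) ^ k := by positivity
    calc |G k y| ≤ B k * 1 := by rw [mul_one]; exact hB k y hy
      _ ≤ B k * ((1 + N) ^ |σ + k| * endpointScale N y ^ (σ + k)) := by
          have := hB0 k
          gcongr
      _ = (B k * (N ^ 2) ^ k * (1 + N) ^ |σ + k|) / (N ^ 2) ^ k *
          endpointScale N y ^ (σ + k) := by field_simp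
      _ ≤ _ := by
          gcongr
          linarith

theorem exists_antiderivBound_jacobiP_of_large (a b : ℝ) (hab : b ≤ a) (K : ℕ) :
    ∃ N₀ : ℕ, ∃ C : ℝ, 0 < C ∧ ∀ n : ℕ, 1 ≤ n → N₀ ≤ n → ∃ G : ℕ → ℝ → ℝ,
      G 0 = jacobiP n a b ∧
      AntiderivBound K (C * (n : ℝ) ^ a) (-a - 1 / 2) n {y | |y| ≤ 1} G := by
  obtain ⟨N₀, hN₀⟩ := exists_nat_ge (2 * (|a + b| + K + 1))
  choose C hC0 hC using fun k : ℕ => abs_jacobiP_le (a - k) (b - k) (by linarith)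
  set D : ℕ → ℝ := fun k => 4 ^ k * (C k * ((k : ℝ) + 1) ^ |a - k| *
    ((k : ℝ) + 1) ^ |-(a - k) - 1 / 2|) with hD
  have hD0 : ∀ k, 0 ≤ D k := fun k => by
    have := hC0 k
    positivity
  refine ⟨N₀, 1 + ∑ k ∈ Finset.range (K + 1), D k, ?_, ?_⟩
  · have : 0 ≤ ∑ k ∈ Finset.range (K + 1), D k := Finset.sum_nonneg fun k _ => hD0 k
    linarith
  intro n hn hNn
  have hn1 : (1 : ℝ) ≤ n := by exact_mod_cast hn
  have hn0 : (0 : ℝ) < n := by linarith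
  have hNn' : 2 * (|a + b| + K + 1) ≤ (n : ℝ) := hN₀.trans (by exact_mod_cast hNn)
  have hden : ∀ i : ℕ, i < K → (n : ℝ) / 2 ≤ n + a + b - i := by
    intro i hi
    have h1 : (i : ℝ) ≤ K := by exact_mod_cast hi.le
    have h2 := neg_abs_le (a + b)
    linarith
  set c : ℕ → ℝ := fun k => ∏ i ∈ Finset.range k, (2 / ((n : ℝ) + a + b - i)) with hc
  have hcb : ∀ k ≤ K, |c k| ≤ (4 / n) ^ k := by
    intro k hk
    rw [hc, Finset.abs_prod]
    calc _ ≤ ∏ _i ∈ Finset.range k, (4 / (n : ℝ)) := by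
          apply Finset.prod_le_prod
          · intros; positivity
          · intro i hi
            have h := hden i ((Finset.mem_range.mp hi).trans_le hk)
            have h' : 0 < (n : ℝ) + a + b - i := by linarith
            rw [abs_of_pos (by positivity), div_le_div_iff₀ h' hn0]
            linarith
      _ = _ := by rw [Finset.prod_const, Finset.card_range]
  refine ⟨fun k t => c k * jacobiP (n + k) (a - k) (b - k) t, ?_, ?_, ?_, ?_⟩
  · funext t
    simp [hc]
  · intro k
    exact continuous_const.mul (continuous_jacobiP _ _ _)
  · intro k hk y
    have h := (hasDerivAt_jacobiP_succ (n + k) (a - (k + 1 : ℕ)) (b - (k + 1 : ℕ)) y).const_mul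
      (c (k + 1))
    refine h.congr_deriv ?_
    have h' : 0 < (n : ℝ) + a + b - k := by
      have := hden k hk
      linarith
    have e1 : a - ((k + 1 : ℕ) : ℝ) + 1 = a - k := by push_cast; ring
    have e2 : b - ((k + 1 : ℕ) : ℝ) + 1 = b - k := by push_cast; ring
    rw [e1, e2, hc]
    simp only [Finset.prod_range_succ]
    push_cast
    field_simp
    ring
  · intro k hk y hy
    have hnk0 : (0 : ℝ) < ((n + k : ℕ) : ℝ) := by positivity
    have hkk : (0 : ℝ) ≤ k := Nat.cast_nonneg k
    have hnk : ((n + k : ℕ) : ℝ) ≤ (k + 1) * n := by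
      push_cast
      nlinarith
    have hnk' : (n : ℝ) ≤ (n + k : ℕ) := by push_cast; linarith
    have hS1 := one_le_endpointScale hn0.le y
    have hS2 := one_le_endpointScale hnk0.le y
    have hs : 0 ≤ √(1 - |y|) := sqrt_nonneg _
    have hS3 : endpointScale (n + k : ℕ) y ≤ (k + 1) * endpointScale n y := by
      unfold endpointScale
      have := mul_le_mul_of_nonneg_right hnk hs
      linarith
    have hS4 : endpointScale n y ≤ endpointScale (n + k : ℕ) y := by
      unfold endpointScale
      gcongr
    have r1 := rpow_le_mul_rpow_of_comparable (K := (k : ℝ) + 1) (a - k) hnk0 hn0 hnk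
      (by nlinarith)
    have r2 := rpow_le_mul_rpow_of_comparable (K := (k : ℝ) + 1) (-(a - k) - 1 / 2)
      (by linarith) (by linarith) hS3 (by nlinarith)
    have hP := hC k (n + k) (by omega) y hy
    have hCk := hC0 k
    have e3 : (n : ℝ) ^ (a - k) = (n : ℝ) ^ a / (n : ℝ) ^ k := by
      rw [rpow_sub hn0, rpow_natCast]
    have e4 : -(a - k) - 1 / 2 = -a - 1 / 2 + (k : ℝ) := by ring
    have hle : D k ≤ ∑ k ∈ Finset.range (K + 1), D k :=
      Finset.single_le_sum (fun k _ => hD0 k) (Finset.mem_range.mpr (by omega))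
    rw [abs_mul]
    calc |c k| * |jacobiP (n + k) (a - k) (b - k) y|
        ≤ (4 / n) ^ k * (C k * (((k : ℝ) + 1) ^ |a - k| * (n : ℝ) ^ (a - k)) *
          (((k : ℝ) + 1) ^ |-(a - k) - 1 / 2| * endpointScale n y ^ (-(a - k) - 1 / 2))) := by
          gcongr
          · exact hcb k hk
          · refine hP.trans ?_
            gcongr
      _ = D k * (n : ℝ) ^ a / ((n : ℝ) ^ 2) ^ k *
          endpointScale n y ^ (-(a - k) - 1 / 2) := by
          rw [e3, hD, div_pow]
          field_simp
          ring
      _ ≤ _ := by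
          rw [e4]
          gcongr
          linarith

theorem exists_antiderivBound_jacobiP (a b : ℝ) (hab : b ≤ a) (K : ℕ) :
    ∃ C : ℝ, 0 < C ∧ ∀ n : ℕ, 1 ≤ n → ∃ G : ℕ → ℝ → ℝ, G 0 = jacobiP n a b ∧
      AntiderivBound K (C * (n : ℝ) ^ a) (-a - 1 / 2) n {y | |y| ≤ 1} G := by
  obtain ⟨N₀, C, hC, h⟩ := exists_antiderivBound_jacobiP_of_large a b hab K
  have hsmall : ∀ n : ℕ, ∃ M : ℝ, 0 < M ∧ (1 ≤ n → ∃ G : ℕ → ℝ → ℝ, G 0 = jacobiP n a b ∧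
      AntiderivBound K M (-a - 1 / 2) n {y | |y| ≤ 1} G) := by
    intro n
    rcases Nat.eq_zero_or_pos n with rfl | hn
    · exact ⟨1, one_pos, fun h => absurd h (by norm_num)⟩
    · obtain ⟨M, hM, hG⟩ := exists_antiderivBound_of_continuous _ (continuous_jacobiP n a b) K
        (-a - 1 / 2) n (by exact_mod_cast hn)
      exact ⟨M, hM, fun _ => hG⟩
  choose M hM0 hM using hsmall
  have hterm : ∀ n : ℕ, 0 ≤ M n / (n : ℝ) ^ a := fun n => by
    have := hM0 n
    positivity
  refine ⟨C + ∑ n ∈ Finset.range N₀, M n / (n : ℝ) ^ a, ?_, ?_⟩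
  · have := Finset.sum_nonneg fun n (_ : n ∈ Finset.range N₀) => hterm n
    linarith
  intro n hn
  have hn0 : (0 : ℝ) < n := by exact_mod_cast hn
  have hna : 0 < (n : ℝ) ^ a := by positivity
  have hsum := Finset.sum_nonneg fun n (_ : n ∈ Finset.range N₀) => hterm n
  rcases lt_or_ge n N₀ with hlt | hge
  · obtain ⟨G, hG0, hG⟩ := hM n hn
    refine ⟨G, hG0, hG.mono hn0.le ?_ le_rfl subset_rfl⟩
    have h1 := Finset.single_le_sum (fun n (_ : n ∈ Finset.range N₀) => hterm n)
      (Finset.mem_range.mpr hlt)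
    rw [← div_le_iff₀ hna]
    linarith
  · obtain ⟨G, hG0, hG⟩ := h n hn hge
    refine ⟨G, hG0, hG.mono hn0.le ?_ le_rfl subset_rfl⟩
    gcongr
    linarith

theorem exists_weight_derivatives (κ : ℝ) (ξ : ℝ → ℝ)
    (hξ : ContDiffOn ℝ (⊤ : ℕ∞) ξ (Set.Icc (-1) 1))
    (hξ0 : ∀ t ∈ Set.Icc (-1 : ℝ) (-(1 / 2)), ξ t = 0) :
    ∃ ζ : ℕ → ℝ → ℝ, ∃ B : ℕ → ℝ, ζ 0 = ξ ∧ (∀ k, ContinuousOn (ζ k) (Set.Icc (-1) 1)) ∧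
      (∀ k, 0 ≤ B k ∧ ∀ t ∈ Set.Icc (-1 : ℝ) 1, |ζ k t| ≤ B k) ∧ (∀ k, ζ k (-1) = 0) ∧
      ∀ k : ℕ, ∀ t ∈ Set.Ioo (-1 : ℝ) 1, HasDerivAt (fun t => ζ k t * (1 - t) ^ (κ - 1 - k))
        (ζ (k + 1) t * (1 - t) ^ (κ - 1 - (k + 1 : ℕ))) t := by
  have hu : UniqueDiffOn ℝ (Set.Icc (-1 : ℝ) 1) := uniqueDiffOn_Icc (by norm_num)
  set ζ : ℕ → ℝ → ℝ := fun k => Nat.rec ξ (fun k f t =>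
    (1 - t) * derivWithin f (Set.Icc (-1) 1) t - (κ - 1 - k) * f t) k with hζ
  have hsucc : ∀ k, ζ (k + 1) = fun t =>
      (1 - t) * derivWithin (ζ k) (Set.Icc (-1) 1) t - (κ - 1 - k) * ζ k t := fun k => rfl
  have hsmooth : ∀ k, ContDiffOn ℝ (⊤ : ℕ∞) (ζ k) (Set.Icc (-1) 1) := by
    intro k
    induction k with
    | zero => exact hξ
    | succ k ih =>
      rw [hsucc]
      have hd : ContDiffOn ℝ (⊤ : ℕ∞) (derivWithin (ζ k) (Set.Icc (-1) 1)) (Set.Icc (-1) 1) :=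
        ih.derivWithin hu (by simp)
      exact ((contDiffOn_const.sub contDiffOn_id).mul hd).sub (contDiffOn_const.mul ih)
  have hzero : ∀ k, ∀ t ∈ Set.Ico (-1 : ℝ) (-(1 / 2)), ζ k t = 0 := by
    intro k
    induction k with
    | zero => exact fun t ht => hξ0 t ⟨ht.1, ht.2.le⟩
    | succ k ih =>
      intro t ht
      have hev : ζ k =ᶠ[nhdsWithin t (Set.Icc (-1) 1)] fun _ => 0 := by
        have : Set.Iio (-(1 / 2) : ℝ) ∈ nhdsWithin t (Set.Icc (-1) 1) :=
          mem_nhdsWithin_of_mem_nhds (Iio_mem_nhds ht.2)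
        filter_upwards [this, self_mem_nhdsWithin] with s hs hs'
        exact ih s ⟨hs'.1, hs⟩
      rw [hsucc]
      simp only
      rw [hev.derivWithin_eq (ih t ht), ih t ht]
      simp
  have hbd : ∀ k, ∃ B : ℝ, 0 ≤ B ∧ ∀ t ∈ Set.Icc (-1 : ℝ) 1, |ζ k t| ≤ B := by
    intro k
    obtain ⟨B, hB⟩ := isCompact_Icc.exists_bound_of_continuousOn (hsmooth k).continuousOn
    exact ⟨B, (norm_nonneg _).trans (hB 0 (by norm_num)), hB⟩
  choose B hB using hbd
  refine ⟨ζ, B, rfl, fun k => (hsmooth k).continuousOn, hB,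
    fun k => hzero k (-1) (by norm_num), fun k t ht => ?_⟩
  have hpos : 0 < 1 - t := by linarith [ht.2]
  have h1 : HasDerivAt (ζ k) (derivWithin (ζ k) (Set.Icc (-1) 1) t) t :=
    (((hsmooth k).differentiableOn (by simp) t
      (Set.Ioo_subset_Icc_self ht)).hasDerivWithinAt).hasDerivAt (Icc_mem_nhds ht.1 ht.2)
  have h2 : HasDerivAt (fun t : ℝ => 1 - t) (-1) t := by
    simpa using (hasDerivAt_id t).const_sub 1
  have h3 := h1.mul (h2.rpow_const (p := κ - 1 - k) (Or.inl hpos.ne'))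
  refine h3.congr_deriv ?_
  have e : (1 - t) ^ (κ - 1 - (k : ℝ)) = (1 - t) * (1 - t) ^ (κ - 1 - (k : ℝ) - 1) := by
    rw [rpow_sub_one hpos.ne']
    field_simp
  have e' : κ - 1 - ((k + 1 : ℕ) : ℝ) = κ - 1 - (k : ℝ) - 1 := by push_cast; ring
  rw [hsucc, e', e]
  ring

theorem endpointScale_sq_le {N y z : ℝ} (hN : 0 ≤ N) (hy : |y| ≤ 1) (hz : |z| ≤ 1) :
    endpointScale N y ^ 2 ≤ 2 * (endpointScale N z ^ 2 + N ^ 2 * |y - z|) := by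
  unfold endpointScale
  have h1 := sq_sqrt (sub_nonneg.mpr hy)
  have h2 := sq_sqrt (sub_nonneg.mpr hz)
  have h3 : |z| - |y| ≤ |y - z| := by
    rw [abs_sub_comm]
    exact abs_sub_abs_le_abs_sub z y
  have h4 := mul_le_mul_of_nonneg_left h3 (sq_nonneg N)
  have h5 := mul_nonneg hN (sqrt_nonneg (1 - |z|))
  have e1 : (N * √(1 - |y|)) ^ 2 = N ^ 2 * (1 - |y|) := by rw [mul_pow, h1]
  have e2 : (N * √(1 - |z|)) ^ 2 = N ^ 2 * (1 - |z|) := by rw [mul_pow, h2]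
  nlinarith [sq_nonneg (N * √(1 - |y|) - 1)]

theorem endpointScale_rpow_le_of_near {N y z : ℝ} (p : ℝ) (hN : 0 ≤ N) (hy : |y| ≤ 1)
    (hz : |z| ≤ 1) (h : N ^ 2 * |y - z| ≤ endpointScale N z) :
    endpointScale N y ^ p ≤ 4 ^ |p| * endpointScale N z ^ p := by
  have h1 := endpointScale_sq_le hN hy hz
  have h2 := endpointScale_sq_le hN hz hy
  rw [abs_sub_comm] at h2
  have hEy := one_le_endpointScale hN y
  have hEz := one_le_endpointScale hN z
  apply rpow_le_mul_rpow_of_comparable p (by linarith) (by linarith)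
  · nlinarith
  · by_contra! hlt
    nlinarith

theorem endpointScale_rpow_le_of_far {N y z r p : ℝ} (hp : 0 ≤ p) (hN : 0 ≤ N) (hy : |y| ≤ 1)
    (hz : |z| ≤ 1) (hr : 1 ≤ r) (h : N ^ 2 * |y - z| ≤ endpointScale N z * r) :
    endpointScale N y ^ p ≤ 2 ^ p * endpointScale N z ^ p * r ^ (p / 2) := by
  have h1 := endpointScale_sq_le hN hy hz
  have hEy := one_le_endpointScale hN y
  have hEz := one_le_endpointScale hN z
  have hsq : √r ^ 2 = r := sq_sqrt (by linarith)
  have hle : endpointScale N y ≤ 2 * endpointScale N z * √r := by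
    refine (sq_le_sq₀ (by linarith) (by positivity)).mp ?_
    rw [mul_pow, hsq]
    nlinarith [mul_le_mul_of_nonneg_left hr (by positivity : 0 ≤ endpointScale N z ^ 2),
      mul_le_mul_of_nonneg_left hEz (by positivity : 0 ≤ endpointScale N z * r)]
  calc endpointScale N y ^ p ≤ (2 * endpointScale N z * √r) ^ p := by gcongr
    _ = _ := by
      rw [mul_rpow (by positivity) (by positivity), mul_rpow (by norm_num) (by positivity),
        sqrt_eq_rpow, ← rpow_mul (by linarith)]
      congr 2
      ring

theorem intervalIntegrable_one_sub_rpow {κ : ℝ} (hκ : 0 < κ) (a b : ℝ) :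
    IntervalIntegrable (fun t : ℝ => (1 - t) ^ (κ - 1)) volume a b := by
  have h := (intervalIntegral.intervalIntegrable_rpow' (a := 1 - a) (b := 1 - b)
    (r := κ - 1) (by linarith)).comp_sub_left 1
  simpa using h

theorem integral_one_sub_rpow {κ δ : ℝ} (hκ : 0 < κ) :
    ∫ t in (1 - δ)..1, (1 - t : ℝ) ^ (κ - 1) = δ ^ κ / κ := by
  have := intervalIntegral.integral_comp_sub_left (a := 1 - δ) (b := 1)
    (fun s : ℝ => s ^ (κ - 1)) 1
  rw [this, integral_rpow (Or.inl (by linarith))]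
  simp [zero_rpow hκ.ne']

theorem integral_one_sub_rpow_neg_le {q δ : ℝ} (hq : 0 < q) (hδ : 0 < δ) (hδ2 : δ ≤ 2) :
    ∫ t in (-1)..(1 - δ), (1 - t : ℝ) ^ (-q - 1) ≤ δ ^ (-q) / q := by
  have := intervalIntegral.integral_comp_sub_left (a := -1) (b := 1 - δ)
    (fun s : ℝ => s ^ (-q - 1)) 1
  rw [this, integral_rpow (Or.inr ⟨by linarith, by
    rw [sub_sub_cancel, Set.uIcc_of_le (by linarith)]
    intro h
    linarith [h.1]⟩)]
  rw [sub_sub_cancel, show (-q - 1 + 1 : ℝ) = -q by ring, div_neg, ← neg_div, neg_sub]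
  have : (0 : ℝ) ≤ (1 - -1) ^ (-q) := by norm_num; positivity
  gcongr
  linarith

theorem abs_integral_le_of_repeated_parts {a b κ : ℝ} (ha : a ≠ 0) (hb : -1 ≤ b) (hb1 : b < 1)
    {g ζ : ℕ → ℝ → ℝ} {B : ℕ → ℝ} {K : ℕ} (hcont : ∀ k, Continuous (g k))
    (hg : ∀ k < K, ∀ t, HasDerivAt (g (k + 1)) (a * g k t) t)
    (hζ : ∀ k, ContinuousOn (ζ k) (Set.Icc (-1) 1))
    (hB : ∀ k, 0 ≤ B k ∧ ∀ t ∈ Set.Icc (-1 : ℝ) 1, |ζ k t| ≤ B k) (hζ0 : ∀ k, ζ k (-1) = 0)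
    (hderiv : ∀ k : ℕ, ∀ t ∈ Set.Ioo (-1 : ℝ) 1,
      HasDerivAt (fun t => ζ k t * (1 - t) ^ (κ - 1 - k))
        (ζ (k + 1) t * (1 - t) ^ (κ - 1 - (k + 1 : ℕ))) t) (ℓ : ℕ) (hℓ : ℓ ≤ K) :
    |∫ t in (-1)..b, g 0 t * (ζ 0 t * (1 - t) ^ (κ - 1))| ≤
      ∑ k ∈ Finset.range ℓ, |g (k + 1) b| * (B k * (1 - b) ^ (κ - 1 - k)) / |a| ^ (k + 1) +
        |∫ t in (-1)..b, g ℓ t * (ζ ℓ t * (1 - t) ^ (κ - 1 - ℓ))| / |a| ^ ℓ := by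
  have ha' : 0 < |a| := abs_pos.mpr ha
  have hφ : ∀ k : ℕ, ContinuousOn (fun t => ζ k t * (1 - t) ^ (κ - 1 - k)) (Set.Icc (-1) b) := by
    intro k
    refine ((hζ k).mono (Set.Icc_subset_Icc_right hb1.le)).mul ?_
    refine ContinuousOn.rpow_const (by fun_prop) fun t ht => Or.inl ?_
    linarith [ht.2]
  induction ℓ with
  | zero => simp
  | succ k ih =>
    refine (ih (by omega)).trans ?_
    rw [Finset.sum_range_succ, add_assoc]
    gcongr
    have hparts := intervalIntegral.integral_mul_deriv_eq_deriv_mul_of_hasDerivAt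
      (a := -1) (b := b) (u := fun t => ζ k t * (1 - t) ^ (κ - 1 - k)) (v := g (k + 1))
      (u' := fun t => ζ (k + 1) t * (1 - t) ^ (κ - 1 - (k + 1 : ℕ))) (v' := fun t => a * g k t)
      (by rw [Set.uIcc_of_le hb]; exact hφ k) (hcont _).continuousOn
      (by
        rw [min_eq_left hb, max_eq_right hb]
        exact fun t ht => hderiv k t ⟨ht.1, ht.2.trans hb1⟩)
      (fun t _ => hg k (by omega) t)
      (ContinuousOn.intervalIntegrable (by rw [Set.uIcc_of_le hb]; exact hφ (k + 1)))
      ((continuous_const.mul (hcont k)).intervalIntegrable _ _)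
    have e1 : ∫ t in (-1)..b, ζ k t * (1 - t) ^ (κ - 1 - k) * (a * g k t) =
        a * ∫ t in (-1)..b, g k t * (ζ k t * (1 - t) ^ (κ - 1 - k)) := by
      rw [← intervalIntegral.integral_const_mul]
      congr 1
      funext t
      ring
    have e2 : ∫ t in (-1)..b, ζ (k + 1) t * (1 - t) ^ (κ - 1 - (k + 1 : ℕ)) * g (k + 1) t =
        ∫ t in (-1)..b, g (k + 1) t * (ζ (k + 1) t * (1 - t) ^ (κ - 1 - (k + 1 : ℕ))) := by
      congr 1
      funext t
      ring
    rw [e1, e2, hζ0, zero_mul, zero_mul, sub_zero] at hparts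
    have h1 : |a| * |∫ t in (-1)..b, g k t * (ζ k t * (1 - t) ^ (κ - 1 - k))| ≤
        |g (k + 1) b| * (B k * (1 - b) ^ (κ - 1 - k)) +
        |∫ t in (-1)..b, g (k + 1) t * (ζ (k + 1) t * (1 - t) ^ (κ - 1 - (k + 1 : ℕ)))| := by
      rw [← abs_mul, hparts]
      refine (abs_sub _ _).trans ?_
      gcongr
      have hb' : 0 ≤ (1 - b) ^ (κ - 1 - (k : ℝ)) := by
        have : 0 ≤ 1 - b := by linarith
        positivity
      rw [abs_mul, abs_mul, abs_of_nonneg hb', mul_comm]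
      gcongr
      exact (hB k).2 b ⟨hb, hb1.le⟩
    rw [← add_div, div_le_div_iff₀ (by positivity) (by positivity), pow_succ]
    calc _ = |a| ^ k * (|a| * |∫ t in (-1)..b, g k t * (ζ k t * (1 - t) ^ (κ - 1 - k))|) := by
          ring
      _ ≤ |a| ^ k * _ := mul_le_mul_of_nonneg_left h1 (by positivity)
      _ = _ := by ring

theorem abs_integral_le_mul_rpow_near {κ δ X : ℝ} (hκ : 0 < κ) (hδ : 0 ≤ δ) {f : ℝ → ℝ}
    (hf : ∀ t ∈ Set.Icc (1 - δ) 1, |f t| ≤ X) :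
    |∫ t in (1 - δ)..1, f t * (1 - t) ^ (κ - 1)| ≤ X * (δ ^ κ / κ) := by
  rw [← integral_one_sub_rpow hκ, ← intervalIntegral.integral_const_mul, ← norm_eq_abs]
  refine intervalIntegral.norm_integral_le_of_norm_le (by linarith) (ae_of_all _ fun t ht => ?_)
    ((intervalIntegrable_one_sub_rpow hκ _ _).const_mul _)
  have : 0 ≤ 1 - t := by linarith [ht.2]
  rw [norm_mul, norm_of_nonneg (by positivity : 0 ≤ (1 - t) ^ (κ - 1))]
  gcongr
  exact hf t ⟨ht.1.le, ht.2⟩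

theorem abs_integral_le_mul_rpow_far {q r s δ X : ℝ} (hq : 0 < q) (hδ : 0 < δ) (hδ2 : δ ≤ 2)
    (hX : 0 ≤ X) (hqrs : r + s = -q - 1) {f : ℝ → ℝ}
    (hf : ∀ t ∈ Set.Icc (-1) (1 - δ), |f t| ≤ X * (1 - t) ^ s) :
    |∫ t in (-1)..(1 - δ), f t * (1 - t) ^ r| ≤ X * (δ ^ (-q) / q) := by
  have hfi : IntervalIntegrable (fun t : ℝ => X * (1 - t) ^ (-q - 1)) volume (-1) (1 - δ) := by
    apply ContinuousOn.intervalIntegrable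
    rw [Set.uIcc_of_le (by linarith)]
    refine continuousOn_const.mul (ContinuousOn.rpow_const (by fun_prop) fun t ht => Or.inl ?_)
    linarith [ht.2]
  calc _ ≤ ∫ t in (-1)..(1 - δ), X * (1 - t) ^ (-q - 1) := by
        rw [← norm_eq_abs]
        refine intervalIntegral.norm_integral_le_of_norm_le (by linarith)
          (ae_of_all _ fun t ht => ?_) hfi
        have : 0 < 1 - t := by linarith [ht.2]
        rw [norm_mul, norm_of_nonneg (by positivity : 0 ≤ (1 - t) ^ r), ← hqrs, add_comm r s,
          rpow_add this, ← mul_assoc]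
        gcongr
        exact hf t ⟨ht.1.le, ht.2⟩
    _ ≤ _ := by
        rw [intervalIntegral.integral_const_mul]
        exact mul_le_mul_of_nonneg_left (integral_one_sub_rpow_neg_le hq hδ hδ2) hX

theorem exists_abs_integral_le_scale_ratio (κ σ : ℝ) (hκ : 0 < κ) (ξ : ℝ → ℝ)
    (hξ : ContDiffOn ℝ (⊤ : ℕ∞) ξ (Set.Icc (-1) 1))
    (hξ0 : ∀ t ∈ Set.Icc (-1 : ℝ) (-(1 / 2)), ξ t = 0) :
    ∃ L : ℕ, ∃ C : ℝ, 0 < C ∧ ∀ (N M a x : ℝ) (G : ℕ → ℝ → ℝ), 1 ≤ N → 0 ≤ M → a ≠ 0 →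
      |x| + |a| ≤ 1 → AntiderivBound L M σ N {y | |y - x| ≤ |a|} G →
      |∫ t in (-1)..1, G 0 (a * t + x) * (ξ t * (1 - t) ^ (κ - 1))| ≤
        C * (M * endpointScale N (a + x) ^ σ *
          (endpointScale N (a + x) / (N ^ 2 * |a|)) ^ κ) := by
  obtain ⟨ζ, B, rfl, hζ, hB, hζ0, hderiv⟩ := exists_weight_derivatives κ ξ hξ hξ0
  obtain ⟨ℓ, hℓ⟩ := exists_nat_gt (max (-σ) (2 * κ + σ))
  have hp : 0 ≤ σ + ℓ := by linarith [le_max_left (-σ) (2 * κ + σ)]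
  set p := σ + ℓ with hp_def
  have hq : 0 < ℓ - κ - p / 2 := by
    rw [hp_def]
    linarith [le_max_right (-σ) (2 * κ + σ)]
  set q := ℓ - κ - p / 2 with hq_def
  set C₁ : ℝ := 4 ^ |σ| * B 0 / κ with hC₁
  set C₂ : ℝ := ∑ k ∈ Finset.range ℓ, 4 ^ |σ + (k + 1 : ℕ)| * B k with hC₂
  set C₃ : ℝ := 2 ^ p * B ℓ / q with hC₃
  have hC₁0 : 0 ≤ C₁ := by have := (hB 0).1; positivity
  have hC₂0 : 0 ≤ C₂ := Finset.sum_nonneg fun k _ => by have := (hB k).1; positivity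
  have hC₃0 : 0 ≤ C₃ := by have := (hB ℓ).1; positivity
  refine ⟨ℓ, 1 + C₁ * (1 + 2 ^ κ) + C₂ + C₃, by positivity, ?_⟩
  intro N M a x G hN hM ha hxa hG
  have ha' : 0 < |a| := abs_pos.mpr ha
  have hN0 : 0 ≤ N := by linarith
  have hNa : 0 < N ^ 2 * |a| := by positivity
  have hD1 := one_le_endpointScale hN0 (a + x)
  set D := endpointScale N (a + x) with hD
  set δ := D / (N ^ 2 * |a|) with hδ_def
  have hδ : 0 < δ := by positivity
  have hδD : N ^ 2 * |a| * δ = D := by rw [hδ_def]; field_simp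
  have hz : |a + x| ≤ 1 := (abs_add_le a x).trans (by linarith)
  have hseg : ∀ t ∈ Set.Icc (-1 : ℝ) 1, |a * t + x - x| ≤ |a| := by
    intro t ht
    rw [add_sub_cancel_right, abs_mul]
    exact mul_le_of_le_one_right ha'.le (abs_le.mpr ht)
  have hy : ∀ t ∈ Set.Icc (-1 : ℝ) 1, |a * t + x| ≤ 1 := by
    intro t ht
    have h1 := abs_add_le (a * t + x - x) x
    rw [sub_add_cancel] at h1
    linarith [hseg t ht]
  have hdist : ∀ t ≤ 1, |a * t + x - (a + x)| = |a| * (1 - t) := by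
    intro t ht
    rw [show a * t + x - (a + x) = -(a * (1 - t)) by ring, abs_neg, abs_mul,
      abs_of_nonneg (by linarith : 0 ≤ 1 - t)]
  have hnear : ∀ k ≤ ℓ, ∀ t ∈ Set.Icc (-1 : ℝ) 1, 1 - δ ≤ t →
      |G k (a * t + x)| ≤ M / (N ^ 2) ^ k * (4 ^ |σ + k| * D ^ (σ + k)) := by
    intro k hk t ht hδt
    refine (hG.bound k hk _ (hseg t ht)).trans ?_
    gcongr
    apply endpointScale_rpow_le_of_near _ hN0 (hy t ht) hz
    rw [hdist t ht.2, ← hD, ← hδD, mul_assoc]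
    gcongr
    linarith
  set X := M * D ^ σ * δ ^ κ with hX
  have hX0 : 0 ≤ X := by positivity
  have hinner : ∀ δ' : ℝ, 0 ≤ δ' → δ' ≤ δ → δ' ≤ 2 →
      |∫ t in (1 - δ')..1, G 0 (a * t + x) * (ζ 0 t * (1 - t) ^ (κ - 1))| ≤ C₁ * X := by
    intro δ' h0 hδ' h2
    have := abs_integral_le_mul_rpow_near (δ := δ') (X := M * (4 ^ |σ| * D ^ σ) * B 0) hκ h0
      (f := fun t => G 0 (a * t + x) * ζ 0 t) (fun t ht => by
        have ht' : t ∈ Set.Icc (-1 : ℝ) 1 := ⟨by linarith [ht.1], ht.2⟩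
        have h := hnear 0 (Nat.zero_le _) t ht' (by linarith [ht.1])
        simp only [pow_zero, div_one, Nat.cast_zero, add_zero] at h
        rw [abs_mul]
        have := (hB 0).1
        gcongr
        exact (hB 0).2 t ht')
    simp only [mul_assoc] at this ⊢
    refine this.trans ?_
    have hpow : δ' ^ κ ≤ δ ^ κ := by gcongr
    have := (hB 0).1
    calc _ ≤ M * (4 ^ |σ| * (D ^ σ * (B 0 * (δ ^ κ / κ)))) := by gcongr
      _ = _ := by rw [hC₁, hX]; ring
  rcases le_or_gt 2 δ with h2 | h2
  · have h := hinner 2 (by norm_num) h2 le_rfl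
    norm_num at h
    refine h.trans ?_
    gcongr
    have : 0 ≤ C₁ * 2 ^ κ := by positivity
    linarith
  have hb : -1 ≤ 1 - δ := by linarith
  have hfi : ∀ u ∈ Set.Icc (-1 : ℝ) 1, ∀ v ∈ Set.Icc (-1 : ℝ) 1, IntervalIntegrable
      (fun t => G 0 (a * t + x) * (ζ 0 t * (1 - t) ^ (κ - 1))) volume u v := by
    intro u hu v hv
    have hsub : Set.uIcc u v ⊆ Set.Icc (-1) 1 := Set.uIcc_subset_Icc hu hv
    simp only [← mul_assoc]
    refine (intervalIntegrable_one_sub_rpow hκ u v).continuousOn_mul ?_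
    exact ((hG.continuous 0).comp (by fun_prop)).continuousOn.mul ((hζ 0).mono hsub)
  rw [← intervalIntegral.integral_add_adjacent_intervals
    (hfi (-1) (by norm_num) (1 - δ) ⟨hb, by linarith⟩)
    (hfi (1 - δ) ⟨hb, by linarith⟩ 1 (by norm_num))]
  refine (abs_add_le _ _).trans ?_
  have hout := abs_integral_le_of_repeated_parts (κ := κ) (K := ℓ)
    (g := fun k t => G k (a * t + x)) ha hb (by linarith : 1 - δ < 1)
    (fun k => (hG.continuous k).comp (by fun_prop))
    (fun k hk t => by
      have h1 : HasDerivAt (fun t : ℝ => a * t + x) a t := by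
        simpa using ((hasDerivAt_id t).const_mul a).add_const x
      exact ((hG.hasDerivAt k hk (a * t + x)).comp t h1).congr_deriv (by ring))
    hζ hB hζ0 hderiv ℓ le_rfl
  have hDk : ∀ k : ℕ, D ^ (σ + k) = D ^ σ * (N ^ 2 * |a| * δ) ^ k := by
    intro k
    rw [rpow_add_natCast (by positivity), hδD]
  have hbdry : ∑ k ∈ Finset.range ℓ, |G (k + 1) (a * (1 - δ) + x)| *
      (B k * (1 - (1 - δ)) ^ (κ - 1 - k)) / |a| ^ (k + 1) ≤ C₂ * X := by
    rw [hC₂, Finset.sum_mul]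
    refine Finset.sum_le_sum fun k hk => ?_
    have h := hnear (k + 1) (Finset.mem_range.mp hk) (1 - δ) ⟨hb, by linarith⟩ le_rfl
    have hBk := (hB k).1
    rw [sub_sub_cancel]
    calc _ ≤ M / (N ^ 2) ^ (k + 1) * (4 ^ |σ + (k + 1 : ℕ)| * D ^ (σ + (k + 1 : ℕ))) *
          (B k * δ ^ (κ - 1 - k)) / |a| ^ (k + 1) := by gcongr
      _ = 4 ^ |σ + (k + 1 : ℕ)| * B k * X := by
        have e : δ ^ κ = δ ^ (κ - 1 - k) * δ ^ (k + 1) := by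
          rw [← rpow_natCast, ← rpow_add hδ]
          congr 1
          push_cast
          ring
        rw [hDk, hX, e, mul_pow, mul_pow]
        field_simp
  have hlast : |∫ t in (-1)..(1 - δ), G ℓ (a * t + x) * (ζ ℓ t * (1 - t) ^ (κ - 1 - ℓ))| /
      |a| ^ ℓ ≤ C₃ * X := by
    have hBl := (hB ℓ).1
    have h := abs_integral_le_mul_rpow_far (q := q) (r := κ - 1 - ℓ) (s := p / 2) (δ := δ)
      (X := M / (N ^ 2) ^ ℓ * (2 ^ p * D ^ p * δ ^ (-(p / 2))) * B ℓ)
      hq hδ h2.le (by positivity) (by rw [hq_def]; ring)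
      (f := fun t => G ℓ (a * t + x) * ζ ℓ t) (fun t ht => by
        have ht' : t ∈ Set.Icc (-1 : ℝ) 1 := ⟨ht.1, by linarith [ht.2]⟩
        have hs : 0 < 1 - t := by linarith [ht.2]
        have hfar := endpointScale_rpow_le_of_far (r := (1 - t) / δ) hp hN0 (hy t ht') hz
          (by rw [one_le_div hδ]; linarith [ht.2]) (by
            rw [hdist t ht'.2, ← hD, ← hδD]
            apply le_of_eq
            field_simp)
        rw [← hD, div_rpow hs.le hδ.le] at hfar
        rw [abs_mul]
        calc _ ≤ M / (N ^ 2) ^ ℓ * (2 ^ p * D ^ p * ((1 - t) ^ (p / 2) / δ ^ (p / 2))) * B ℓ := by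
              gcongr
              · exact (hG.bound ℓ le_rfl _ (hseg t ht')).trans (by gcongr)
              · exact (hB ℓ).2 t ht'
          _ = _ := by rw [rpow_neg hδ.le]; ring)
    simp only [mul_assoc] at h ⊢
    rw [div_le_iff₀ (by positivity)]
    refine h.trans (le_of_eq ?_)
    have e : δ ^ (-(p / 2)) * δ ^ (-q) * δ ^ ℓ = δ ^ κ := by
      rw [← rpow_natCast, ← rpow_add hδ, ← rpow_add hδ]
      congr 1
      rw [hq_def]
      ring
    rw [hC₃, hX, ← e, hp_def, hDk, mul_pow, mul_pow, ← hp_def]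
    field_simp
  have hin := hinner δ hδ.le le_rfl h2.le
  simp only [hδ_def] at hin hbdry hlast hout ⊢
  have h5 : 0 ≤ C₁ * 2 ^ κ * X := by positivity
  nlinarith

theorem exists_bound_comp_affine {g : ℝ → ℝ} (hg : Continuous g) (a y₀ : ℝ) :
    ∃ B : ℝ, 0 ≤ B ∧ ∀ y ∈ Metric.closedBall y₀ 1, ∀ t ∈ Set.uIoc (-1 : ℝ) 1,
      |g (a * t + y - a)| ≤ B := by
  obtain ⟨B, hB⟩ := ((isCompact_closedBall y₀ 1).prod
    (isCompact_Icc (a := (-1 : ℝ)) (b := 1))).exists_bound_of_continuousOn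
    (f := fun z : ℝ × ℝ => g (a * z.2 + z.1 - a)) (by fun_prop)
  refine ⟨B, (norm_nonneg _).trans (hB (y₀, 0) ⟨by simp, by norm_num⟩), fun y hy t ht => ?_⟩
  rw [Set.uIoc_of_le (by norm_num)] at ht
  exact hB (y, t) ⟨hy, Set.Ioc_subset_Icc_self ht⟩

theorem intervalIntegrable_comp_affine_mul {g w : ℝ → ℝ} (hg : Continuous g)
    (hw : IntervalIntegrable w volume (-1) 1) (a y : ℝ) :
    IntervalIntegrable (fun t => g (a * t + y - a) * w t) volume (-1) 1 :=
  hw.continuousOn_mul (by fun_prop)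

theorem continuous_integral_comp_affine {g w : ℝ → ℝ} (hg : Continuous g)
    (hw : IntervalIntegrable w volume (-1) 1) (a : ℝ) :
    Continuous fun y => ∫ t in (-1)..1, g (a * t + y - a) * w t := by
  rw [continuous_iff_continuousAt]
  intro y₀
  obtain ⟨B, hB0, hB⟩ := exists_bound_comp_affine hg a y₀
  refine intervalIntegral.continuousAt_of_dominated_interval (bound := fun t => B * |w t|)
    (Filter.Eventually.of_forall fun y => ?_) ?_ (hw.abs.const_mul B) ?_
  · exact (intervalIntegrable_comp_affine_mul hg hw a y).def'.aestronglyMeasurable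
  · filter_upwards [Metric.closedBall_mem_nhds y₀ one_pos] with y hy
    refine ae_of_all _ fun t ht => ?_
    rw [norm_mul]
    exact mul_le_mul_of_nonneg_right (hB y hy t ht) (norm_nonneg _)
  · exact ae_of_all _ fun t _ => (Continuous.continuousAt (by fun_prop))

theorem hasDerivAt_integral_comp_affine {g g' w : ℝ → ℝ} (hg : ∀ y, HasDerivAt g (g' y) y)
    (hg' : Continuous g') (hw : IntervalIntegrable w volume (-1) 1) (a y₀ : ℝ) :
    HasDerivAt (fun y => ∫ t in (-1)..1, g (a * t + y - a) * w t)
      (∫ t in (-1)..1, g' (a * t + y₀ - a) * w t) y₀ := by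
  have hgc : Continuous g := continuous_iff_continuousAt.mpr fun y => (hg y).continuousAt
  obtain ⟨B, hB0, hB⟩ := exists_bound_comp_affine hg' a y₀
  refine (intervalIntegral.hasDerivAt_integral_of_dominated_loc_of_deriv_le
    (F' := fun y t => g' (a * t + y - a) * w t)
    (bound := fun t => B * |w t|) (Metric.closedBall_mem_nhds y₀ one_pos)
    (Filter.Eventually.of_forall fun y => ?_) (intervalIntegrable_comp_affine_mul hgc hw a y₀)
    ?_ ?_ (hw.abs.const_mul B) ?_).2
  · exact (intervalIntegrable_comp_affine_mul hgc hw a y).def'.aestronglyMeasurable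
  · exact (intervalIntegrable_comp_affine_mul hg' hw a y₀).def'.aestronglyMeasurable
  · refine ae_of_all _ fun t ht y hy => ?_
    rw [norm_mul]
    exact mul_le_mul_of_nonneg_right (hB y hy t ht) (norm_nonneg _)
  · refine ae_of_all _ fun t _ y _ => ?_
    have h1 : HasDerivAt (fun y : ℝ => a * t + y - a) 1 y :=
      ((hasDerivAt_id y).const_add (a * t)).sub_const a
    exact (((hg _).comp y h1).mul_const (w t)).congr_deriv (by ring)

theorem AntiderivBound.shift {K L : ℕ} {M σ N : ℝ} {S : Set ℝ} {G : ℕ → ℝ → ℝ} {k : ℕ}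
    (h : AntiderivBound L M σ N S G) (hk : k + K ≤ L) :
    AntiderivBound K (M / (N ^ 2) ^ k) (σ + k) N S fun i => G (k + i) where
  continuous i := h.continuous (k + i)
  hasDerivAt i hi y := h.hasDerivAt (k + i) (by omega) y
  bound i hi y hy := by
    refine (h.bound (k + i) (by omega) y hy).trans (le_of_eq ?_)
    rw [div_div, ← pow_add, Nat.cast_add, add_assoc]

theorem intervalIntegrable_weight {κ : ℝ} (hκ : 0 < κ) {ξ : ℝ → ℝ}
    (hξ : ContDiffOn ℝ (⊤ : ℕ∞) ξ (Set.Icc (-1) 1)) :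
    IntervalIntegrable (fun t => ξ t * (1 - t) ^ (κ - 1)) volume (-1) 1 :=
  (intervalIntegrable_one_sub_rpow hκ _ _).continuousOn_mul (by
    rw [Set.uIcc_of_le (by norm_num)]
    exact hξ.continuousOn)

theorem exists_antiderivBound_integral (κ σ : ℝ) (hκ : 0 < κ) (ξ : ℝ → ℝ)
    (hξ : ContDiffOn ℝ (⊤ : ℕ∞) ξ (Set.Icc (-1) 1))
    (hξ0 : ∀ t ∈ Set.Icc (-1 : ℝ) (-(1 / 2)), ξ t = 0) (K : ℕ) :
    ∃ L : ℕ, ∃ C : ℝ, 0 < C ∧ ∀ (N M a : ℝ) (S T : Set ℝ) (G : ℕ → ℝ → ℝ), 1 ≤ N → 0 ≤ M →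
      a ≠ 0 → (∀ y ∈ T, |y - a| + |a| ≤ 1) → (∀ y ∈ T, ∀ z, |z - (y - a)| ≤ |a| → z ∈ S) →
      AntiderivBound L M σ N S G →
      AntiderivBound K (C * M * ((N ^ 2) ^ (-κ) * |a| ^ (-κ))) (σ + κ) N T
        fun k y => ∫ t in (-1)..1, G k (a * t + y - a) * (ξ t * (1 - t) ^ (κ - 1)) := by
  choose L C hC0 hC using fun k : ℕ => exists_abs_integral_le_scale_ratio κ (σ + k) hκ ξ hξ hξ0
  have hw := intervalIntegrable_weight hκ hξ
  refine ⟨K + ∑ k ∈ Finset.range (K + 1), L k, 1 + ∑ k ∈ Finset.range (K + 1), C k, ?_, ?_⟩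
  · have : 0 ≤ ∑ k ∈ Finset.range (K + 1), C k := Finset.sum_nonneg fun k _ => (hC0 k).le
    linarith
  intro N M a S T G hN hM ha hT hTS hG
  have hN0 : 0 ≤ N := by linarith
  have ha' : 0 < |a| := abs_pos.mpr ha
  refine ⟨fun k => continuous_integral_comp_affine (hG.continuous k) hw a,
    fun k hk y => hasDerivAt_integral_comp_affine (hG.hasDerivAt k (by omega))
      (hG.continuous k) hw a y, fun k hk y hy => ?_⟩
  have hmem : k ∈ Finset.range (K + 1) := Finset.mem_range.mpr (by omega)
  have hL : L k ≤ ∑ k ∈ Finset.range (K + 1), L k :=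
    Finset.single_le_sum (fun _ _ => Nat.zero_le _) hmem
  have hCk : C k ≤ ∑ k ∈ Finset.range (K + 1), C k :=
    Finset.single_le_sum (fun k _ => (hC0 k).le) hmem
  have hshift : AntiderivBound (L k) (M / (N ^ 2) ^ k) (σ + k) N {z | |z - (y - a)| ≤ |a|}
      fun i => G (k + i) :=
    (hG.shift (k := k) (K := L k) (by omega)).mono hN0 le_rfl le_rfl fun z hz => hTS y hy z hz
  have h := hC k N (M / (N ^ 2) ^ k) a (y - a) _ hN (by positivity) ha (hT y hy) hshift
  have hE := one_le_endpointScale hN0 y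
  simp only [add_zero, add_sub_cancel, ← add_sub_assoc] at h
  refine h.trans ?_
  rw [div_rpow (by positivity) (by positivity), mul_rpow (by positivity) (by positivity),
    add_right_comm σ κ, rpow_add (by positivity) (σ + k) κ, rpow_neg (by positivity),
    rpow_neg (by positivity)]
  calc _ = C k * (M / (N ^ 2) ^ k * endpointScale N y ^ (σ + k) *
        (endpointScale N y ^ κ / ((N ^ 2) ^ κ * |a| ^ κ))) := rfl
    _ ≤ (1 + ∑ k ∈ Finset.range (K + 1), C k) * (M / (N ^ 2) ^ k * endpointScale N y ^ (σ + k) *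
        (endpointScale N y ^ κ / ((N ^ 2) ^ κ * |a| ^ κ))) := by
      gcongr
      linarith
    _ = _ := by
      have h1 : 0 < (N ^ 2) ^ κ := by positivity
      have h2 : 0 < |a| ^ κ := by positivity
      field_simp

theorem volume_restrict_cube (m : ℕ) :
    (volume : Measure (Fin m → ℝ)).restrict (cube m) =
      Measure.pi fun _ => volume.restrict (Set.Icc (-1 : ℝ) 1) := by
  rw [cube, volume_pi, Measure.restrict_pi_pi]

theorem isCompact_cube (m : ℕ) : IsCompact (cube m) :=
  isCompact_univ_pi fun _ => isCompact_Icc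

theorem integral_cube_succ {m : ℕ} {g : ℝ → ℝ} (hg : Continuous g) (a : Fin (m + 1) → ℝ)
    {w : Fin (m + 1) → ℝ → ℝ} (hw : ∀ j, IntervalIntegrable (w j) volume (-1) 1) (x : ℝ) :
    ∫ t in cube (m + 1), g (∑ j, a j * t j + x) * ∏ j, w j (t j) =
      ∫ s in (-1)..1, (∫ t in cube m, g (∑ j : Fin m, a j.succ * t j + (a 0 * s + x)) *
        ∏ j : Fin m, w j.succ (t j)) * w 0 s := by
  set μ : Measure ℝ := volume.restrict (Set.Icc (-1 : ℝ) 1) with hμ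
  have hw' : ∀ j, Integrable (w j) μ := fun j =>
    (intervalIntegrable_iff_integrableOn_Icc_of_le (by norm_num)).mp (hw j)
  have hprod : IntegrableOn (fun t : Fin (m + 1) → ℝ => ∏ j, w j (t j)) (cube (m + 1)) := by
    rw [IntegrableOn, volume_restrict_cube]
    exact Integrable.fintype_prod hw'
  have hfi : Integrable (fun t : Fin (m + 1) → ℝ => g (∑ j, a j * t j + x) * ∏ j, w j (t j))
      (Measure.pi fun _ => μ) := by
    rw [hμ, ← volume_restrict_cube]
    exact IntegrableOn.continuousOn_mul (by fun_prop) hprod (isCompact_cube _)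
  have hmp := (measurePreserving_piFinSuccAbove (fun _ : Fin (m + 1) => μ) 0).symm
  have hemb :=
    (MeasurableEquiv.piFinSuccAbove (fun _ : Fin (m + 1) => ℝ) 0).symm.measurableEmbedding
  rw [volume_restrict_cube, ← hμ, ← hmp.integral_comp hemb]
  have hfi' := (hmp.integrable_comp_emb hemb).mpr hfi
  refine (integral_prod _ hfi').trans ?_
  rw [intervalIntegral.integral_of_le (by norm_num),
    ← integral_Icc_eq_integral_Ioc, ← hμ]
  congr 1
  funext s
  rw [← integral_mul_const, volume_restrict_cube]
  congr 1
  funext t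
  simp only [Function.comp_apply, MeasurableEquiv.piFinSuccAbove_symm_apply,
    Fin.insertNthEquiv_zero, Fin.consEquiv_apply, Fin.sum_univ_succ, Fin.prod_univ_succ,
    Fin.cons_zero, Fin.cons_succ]
  rw [show a 0 * s + ∑ j : Fin m, a j.succ * t j + x =
    ∑ j : Fin m, a j.succ * t j + (a 0 * s + x) by ring]
  ring

theorem exists_antiderivBound_cube_integral (m : ℕ) : ∀ (κ : Fin m → ℝ) (ξ : Fin m → ℝ → ℝ),
    (∀ j, 0 < κ j) → (∀ j, ContDiffOn ℝ (⊤ : ℕ∞) (ξ j) (Set.Icc (-1) 1)) →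
    (∀ j, ∀ t ∈ Set.Icc (-1 : ℝ) (-(1 / 2)), ξ j t = 0) → ∀ (σ : ℝ) (K : ℕ),
    ∃ L : ℕ, ∃ C : ℝ, 0 < C ∧ ∀ (N M : ℝ) (a : Fin m → ℝ) (G : ℕ → ℝ → ℝ), 1 ≤ N → 0 ≤ M →
      (∀ j, a j ≠ 0) → AntiderivBound L M σ N {y | |y| ≤ 1} G →
      AntiderivBound K (C * M * ∏ j, ((N ^ 2) ^ (-κ j) * |a j| ^ (-κ j))) (σ + ∑ j, κ j) N
        {y | |y - ∑ j, a j| ≤ 1 - ∑ j, |a j|} fun k y => ∫ t in cube m,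
          G k (∑ j, a j * t j + (y - ∑ j, a j)) * ∏ j, ξ j (t j) * (1 - t j) ^ (κ j - 1) := by
  induction m with
  | zero =>
    intro κ ξ _ _ _ σ K
    refine ⟨K, 1, one_pos, fun N M a G _ _ _ hG => ?_⟩
    have hvol : ∀ c : ℝ, ∫ _ in cube 0, c = c := by
      intro c
      rw [volume_restrict_cube]
      simp [measureReal_def]
    simpa [hvol] using hG
  | succ m ih =>
    intro κ ξ hκ hξ hξ0 σ K
    obtain ⟨L₁, C₁, hC₁, h₁⟩ := exists_antiderivBound_integral (κ 0)
      (σ + ∑ j : Fin m, κ j.succ) (hκ 0) (ξ 0) (hξ 0) (hξ0 0) K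
    obtain ⟨L, C, hC, h⟩ := ih (fun j => κ j.succ) (fun j => ξ j.succ) (fun j => hκ _)
      (fun j => hξ _) (fun j => hξ0 _) σ L₁
    refine ⟨L, C₁ * C, by positivity, fun N M a G hN hM ha hG => ?_⟩
    have hF := h N M (fun j => a j.succ) G hN hM (fun j => ha _) hG
    have hM' : 0 ≤ C * M * ∏ j : Fin m, ((N ^ 2) ^ (-κ j.succ) * |a j.succ| ^ (-κ j.succ)) :=
      mul_nonneg (by positivity) (Finset.prod_nonneg fun j _ => by positivity)
    have hH := h₁ N _ (a 0) _ {y | |y - ∑ j, a j| ≤ 1 - ∑ j, |a j|} _ hN hM' (ha 0)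
      (fun y hy => by
        simp only [Set.mem_ofPred_eq, Fin.sum_univ_succ] at hy
        have h1 := Finset.abs_sum_le_sum_abs (fun j : Fin m => a j.succ) Finset.univ
        have h2 := abs_add_le (y - (a 0 + ∑ j : Fin m, a j.succ)) (∑ j : Fin m, a j.succ)
        rw [show y - (a 0 + ∑ j : Fin m, a j.succ) + ∑ j : Fin m, a j.succ = y - a 0 by ring]
          at h2
        linarith)
      (fun y hy z hz => by
        simp only [Set.mem_ofPred_eq, Fin.sum_univ_succ] at hy ⊢
        have h2 := abs_add_le (z - (y - a 0)) (y - (a 0 + ∑ j : Fin m, a j.succ))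
        rw [show z - (y - a 0) + (y - (a 0 + ∑ j : Fin m, a j.succ)) =
          z - ∑ j : Fin m, a j.succ by ring] at h2
        linarith) hF
    have eH : (fun k y => ∫ t in cube (m + 1), G k (∑ j, a j * t j + (y - ∑ j, a j)) *
          ∏ j, ξ j (t j) * (1 - t j) ^ (κ j - 1)) =
        fun k y => ∫ s in (-1)..1, (∫ t in cube m, G k (∑ j : Fin m, a j.succ * t j +
          (a 0 * s + y - a 0 - ∑ j : Fin m, a j.succ)) *
          ∏ j : Fin m, ξ j.succ (t j) * (1 - t j) ^ (κ j.succ - 1)) *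
          (ξ 0 s * (1 - s) ^ (κ 0 - 1)) := by
      funext k y
      rw [integral_cube_succ (hG.continuous k) a
        (w := fun j t => ξ j t * (1 - t) ^ (κ j - 1))
        (fun j => intervalIntegrable_weight (hκ j) (hξ j))]
      congr 1
      funext s
      rw [Fin.sum_univ_succ]
      congr 2
      funext t
      congr 2
      ring
    rw [eH, Fin.prod_univ_succ, Fin.sum_univ_succ]
    convert hH using 1 <;> ring

/-- Lemma 3.5: for `κ_j > 0`, `ξ_j ∈ C^∞[-1,1]` vanishing on
`[-1,-1/2]`, and `α ≥ β`, there is `c > 0` such that for all `n ≥ 1`, `a_j ≠ 0` with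
`Σ|a_j| ≤ 1` and `|x| ≤ 1 - Σ|a_j|`,
`|f_m(x)| ≤ c n^{α-2τ_m} (1+n√(1-|A_m+x|))^{-α-1/2+τ_m} ∏ |a_j|^{-κ_j}`, where
`f_m(x) = ∫_{[-1,1]^m} P_n^{(α,β)}(Σ a_j t_j + x) ∏ ξ_j(t_j)(1-t_j)^{κ_j-1} dt`,
`A_m = Σ a_j` and `τ_m = Σ κ_j`. -/
theorem jacobi_integral_estimate_one_sided (m : ℕ) (hm : 1 ≤ m) (κ : Fin m → ℝ)
    (hκ : ∀ j, 0 < κ j) (ξ : Fin m → ℝ → ℝ)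
    (hξ : ∀ j, ContDiffOn ℝ (⊤ : ℕ∞) (ξ j) (Set.Icc (-1) 1))
    (hξ0 : ∀ j, ∀ t ∈ Set.Icc (-1 : ℝ) (-(1 / 2)), ξ j t = 0)
    (α β : ℝ) (hαβ : β ≤ α) :
    ∃ c : ℝ, 0 < c ∧ ∀ n : ℕ, 1 ≤ n → ∀ a : Fin m → ℝ, (∀ j, a j ≠ 0) →
      (∑ j, |a j|) ≤ 1 → ∀ x : ℝ, |x| ≤ 1 - ∑ j, |a j| →
      |∫ t in cube m,
          jacobiP n α β ((∑ j, a j * t j) + x) * ∏ j, ξ j (t j) * (1 - t j) ^ (κ j - 1)| ≤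
        c * (n : ℝ) ^ (α - 2 * ∑ j, κ j) *
          (1 + (n : ℝ) * Real.sqrt (1 - |(∑ j, a j) + x|)) ^ (-α - 1 / 2 + ∑ j, κ j) *
          ∏ j, |a j| ^ (-κ j) := by
  obtain ⟨L, C, hC, h⟩ := exists_antiderivBound_cube_integral m κ ξ hκ hξ hξ0 (-α - 1 / 2) 0
  obtain ⟨C', hC', hP⟩ := exists_antiderivBound_jacobiP α β hαβ L
  refine ⟨C * C', by positivity, fun n hn a ha _ x hx => ?_⟩
  obtain ⟨G, hG0, hG⟩ := hP n hn
  have hn1 : (1 : ℝ) ≤ n := by exact_mod_cast hn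
  have hn0 : (0 : ℝ) < n := by linarith
  have hb := (h n _ a G hn1 (by positivity) ha hG).bound 0 le_rfl (∑ j, a j + x)
    (by simpa using hx)
  simp only [hG0, add_sub_cancel_left, pow_zero, div_one, Nat.cast_zero, add_zero] at hb
  refine hb.trans (le_of_eq ?_)
  have e : ∏ j, ((n : ℝ) ^ 2) ^ (-κ j) = (n : ℝ) ^ (-(2 * ∑ j, κ j)) := by
    rw [← rpow_sum_of_pos (by positivity), Finset.sum_neg_distrib, ← rpow_natCast,
      ← rpow_mul hn0.le]
    congr 1
    push_cast
    ring
  rw [Finset.prod_mul_distrib, e, sub_eq_add_neg α, rpow_add hn0, endpointScale]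
  ring
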